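/- (Dirichlet's class number formula for prime discriminant) Let p > 3 be a prime with p ≡ 3 (mod 4), let k = ℚ(√-p), and let h be the class number of k. Then h = -(1/p) · Σ_{a=1}^{p-1} (a|p)·a, where (a|p) is the Legendre symbol. -/

import Mathlib

open Polynomial in
lemma cyclotomic_prime_zmod (p : ℕ) [Fact p.Prime] :
    cyclotomic p (ZMod p) = (X - 1) ^ (p - 1) := by
  have h := cyclotomic_prime_mul_X_sub_one (ZMod p) p
  have h2 : (X - 1 : (ZMod p)[X]) ^ p = X ^ p - 1 := by simpa using sub_pow_char (R := (ZMod p)[X]) (p := p) X 1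
  have hX : (X - 1 : (ZMod p)[X]) ≠ 0 := by simpa using X_sub_C_ne_zero (1 : ZMod p)
  apply mul_right_cancel₀ hX
  rw [h, ← pow_succ, Nat.sub_add_cancel (Fact.out : p.Prime).one_le, h2]

open Polynomial in
lemma ZMod.sum_pow_mul_eval_of_monic (p m : ℕ) [Fact p.Prime] (hm : p = 2 * m + 1) (hm0 : 0 < m)
    {q : (ZMod p)[X]} (hq : q.Monic) (hd : q.natDegree = m) :
    ∑ x : ZMod p, x ^ m * q.eval x = -1 := by
  have hc : Fintype.card (ZMod p) = p := ZMod.card p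
  simp_rw [eval_eq_sum_range, hd, Finset.mul_sum]
  rw [Finset.sum_comm, Finset.sum_range_succ, Finset.sum_eq_zero]
  · have h1 : q.coeff m = 1 := by rw [← hd]; exact hq
    have h2 : ∀ x : ZMod p, x ^ m * (q.coeff m * x ^ m) = if x = 0 then 0 else 1 := by
      intro x
      rw [h1, one_mul, ← pow_add]
      split_ifs with h
      · rw [h, zero_pow (by lia)]
      · rw [← ZMod.pow_card_sub_one_eq_one h]; congr 1; lia
    simp only [h2]
    rw [Finset.sum_ite]
    simp [Finset.filter_ne', Finset.card_erase_of_mem, hc]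
    rw [Nat.cast_sub (by lia)]; simp
  · intro i hi
    rw [Finset.mem_range] at hi
    have := FiniteField.sum_pow_lt_card_sub_one (ZMod p) (m + i) (by rw [hc]; lia)
    simp_rw [mul_left_comm _ (q.coeff i), ← pow_add, ← Finset.mul_sum, this, mul_zero]

lemma ZMod.sum_range_cast {M : Type*} [AddCommMonoid M] (p : ℕ) [NeZero p] (f : ZMod p → M) :
    ∑ j ∈ Finset.range p, f (j : ZMod p) = ∑ x : ZMod p, f x := by
  refine Finset.sum_bij' (fun j _ ↦ (j : ZMod p)) (fun x _ ↦ x.val) ?_ ?_ ?_ ?_ ?_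
  · simp
  · intro a _; simpa using ZMod.val_lt a
  · intro a ha; exact ZMod.val_cast_of_lt (by simpa using ha)
  · simp
  · simp

/-- Comparing Taylor coefficients at `1` modulo `p` of the Gauss sum and of the product
`∏ (η ^ k - η ^ (-k))`. -/
lemma legendre_sum_eq_mul_prod_mod (p m : ℕ) [Fact p.Prime] (hm : p = 2 * m + 1) (hm0 : 0 < m)
    {η : ℂ} (hη : IsPrimitiveRoot η p) (ε : ℤ)
    (h : ∑ j ∈ Finset.range p, (legendreSym p j : ℂ) * η ^ j =
      ε * ∏ k ∈ Finset.range m, (η ^ (k + 1) - η ^ (p - (k + 1)))) :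
    (ε * (2 ^ m * (m.factorial : ZMod p) ^ 2) : ZMod p) = -1 := by
  open Polynomial in
  have hp : p.Prime := Fact.out
  set A : ℤ[X] := ∑ j ∈ Finset.range p, C (legendreSym p j) * X ^ j with hA
  set B : ℤ[X] := ∏ k ∈ Finset.range m, (X ^ (k + 1) - X ^ (p - (k + 1))) with hB
  have h0 : aeval η (A - C ε * B) = 0 := by
    simp only [hA, hB, map_sub, map_sum, map_mul, map_pow, aeval_X, aeval_C, map_prod]
    rw [sub_eq_zero]
    simpa using h
  have h1 : cyclotomic p ℤ ∣ A - C ε * B := by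
    rw [cyclotomic_eq_minpoly hη hp.pos]
    exact minpoly.isIntegrallyClosed_dvd (hη.isIntegral hp.pos) h0
  have h2 : (X - 1 : (ZMod p)[X]) ^ (p - 1) ∣ (A - C ε * B).map (Int.castRingHom (ZMod p)) := by
    rw [← cyclotomic_prime_zmod, ← map_cyclotomic_int p (ZMod p)]
    exact Polynomial.map_dvd _ h1
  have h3 : (taylor 1 ((A - C ε * B).map (Int.castRingHom (ZMod p)))).coeff m = 0 := by
    obtain ⟨g, hg⟩ := h2
    rw [hg, taylor_mul, taylor_pow]
    have : taylor (1 : ZMod p) (X - 1) = X := by simp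
    rw [this, coeff_X_pow_mul', if_neg (by lia)]
  have hA1 : (m.factorial : ZMod p) * (taylor 1 (A.map (Int.castRingHom (ZMod p)))).coeff m = -1 := by
    rw [← ZMod.sum_pow_mul_eval_of_monic p m hm hm0 (monic_descPochhammer (ZMod p) m)
      (descPochhammer_natDegree (ZMod p) m), ← ZMod.sum_range_cast p]
    simp only [hA, Polynomial.map_sum, map_sum, finsetSum_coeff, Finset.mul_sum]
    refine Finset.sum_congr rfl fun j _ ↦ ?_
    rw [descPochhammer_eval_eq_descFactorial, Nat.descFactorial_eq_factorial_mul_choose]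
    simp only [Polynomial.map_mul, Polynomial.map_pow, map_C, map_X, taylor_mul, taylor_pow,
      taylor_X, taylor_C, coeff_C_mul, map_one, coeff_X_add_one_pow]
    have := legendreSym.eq_pow p j
    rw [show p / 2 = m by lia] at this
    simp only [eq_intCast, this]
    push_cast
    ring
  have hB1 : (taylor 1 (B.map (Int.castRingHom (ZMod p)))).coeff m = 2 ^ m * m.factorial := by
    have key : ∀ k ∈ Finset.range m, ∃ g : (ZMod p)[X], g.coeff 0 = 2 * ((k + 1 : ℕ) : ZMod p) ∧
        taylor 1 (X ^ (k + 1) - X ^ (p - (k + 1))) = X * g := by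
      intro k hk
      rw [Finset.mem_range] at hk
      set T : (ZMod p)[X] := taylor 1 (X ^ (k + 1) - X ^ (p - (k + 1))) with hT
      refine ⟨divX T, ?_, ?_⟩
      · rw [coeff_divX, hT]
        simp only [map_sub, taylor_pow, taylor_X, map_one, coeff_sub, coeff_X_add_one_pow]
        simp [Nat.cast_sub (show k + 1 ≤ p by lia)]
        ring
      · conv_lhs => rw [← X_mul_divX_add T]
        have : T.coeff 0 = 0 := by
          simp [hT, coeff_X_add_one_pow]
        rw [this]; simp
    choose! g hg0 hg using key
    have : taylor 1 (B.map (Int.castRingHom (ZMod p))) = X ^ m * ∏ k ∈ Finset.range m, g k := by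
      rw [hB, Polynomial.map_prod, ← taylorAlgHom_apply, map_prod]
      simp only [Polynomial.map_sub, Polynomial.map_pow, map_X, taylorAlgHom_apply]
      rw [Finset.prod_congr rfl hg, Finset.prod_mul_distrib]
      simp
    rw [this, coeff_X_pow_mul', if_pos le_rfl, Nat.sub_self, coeff_zero_prod,
      Finset.prod_congr rfl hg0, Finset.prod_mul_distrib, ← Nat.cast_prod,
      Finset.prod_range_add_one_eq_factorial]
    simp
  simp only [Polynomial.map_sub, Polynomial.map_mul, map_C, map_sub, taylor_mul, taylor_C,
    coeff_sub, coeff_C_mul, hB1, sub_eq_zero] at h3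
  rw [h3] at hA1
  rw [← hA1]
  simp only [eq_intCast]
  ring

/-- The square of `m!` modulo a prime `p = 2m+1` with `m` odd. -/
lemma ZMod.factorial_half_sq (p m : ℕ) [Fact p.Prime] (hm : p = 2 * m + 1) (hodd : Odd m) :
    (m.factorial : ZMod p) ^ 2 = 1 := by
  have hw := ZMod.wilsons_lemma p
  have h1 : (p - 1).factorial = m.factorial * (m + 1).ascFactorial m := by
    rw [Nat.factorial_mul_ascFactorial]; congr 1; lia
  have h2 : (((m + 1).ascFactorial m : ℕ) : ZMod p) = (-1) ^ m * m.factorial := by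
    rw [Nat.ascFactorial_eq_prod_range, ← Finset.prod_range_add_one_eq_factorial,
      ← Finset.prod_range_reflect]
    push_cast
    rw [← Finset.card_range m, ← Finset.prod_const, Finset.card_range, ← Finset.prod_mul_distrib]
    refine Finset.prod_congr rfl fun j hj ↦ ?_
    rw [Finset.mem_range] at hj
    have : (p : ZMod p) = 0 := CharP.cast_eq_zero _ _
    have h3 : ((m + 1 + (m - 1 - j) : ℕ) : ZMod p) + ((j + 1 : ℕ) : ZMod p) = 0 := by
      rw [← this, ← Nat.cast_add]; congr 1; lia
    push_cast at h3 ⊢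
    linear_combination h3
  rw [h1, Nat.cast_mul, h2, hodd.neg_one_pow] at hw
  linear_combination -hw

open Complex in
lemma prod_sin_sq (p m : ℕ) (hm : p = 2 * m + 1) :
    (∏ k ∈ Finset.range m, (2 * Real.sin (Real.pi * (k + 1) / p))) ^ 2 = p := by
  have hp0 : p ≠ 0 := by lia
  have hζ := Complex.isPrimitiveRoot_exp p hp0
  set ζ := exp (2 * Real.pi * I / p) with hζd
  have h1 : ∀ k : ℕ, k + 1 < p → ‖1 - ζ ^ (k + 1)‖ = 2 * Real.sin (Real.pi * (k + 1) / p) := by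
    intro k hk
    have : ζ ^ (k + 1) = exp (I * ((2 * Real.pi * (k + 1) / p : ℝ) : ℂ)) := by
      rw [hζd, ← exp_nat_mul]; congr 1; push_cast; ring
    rw [this, norm_sub_rev, Complex.norm_exp_I_mul_ofReal_sub_one, Real.norm_eq_abs,
      abs_of_nonneg]
    · congr 2; ring
    · refine mul_nonneg zero_le_two (Real.sin_nonneg_of_nonneg_of_le_pi (by positivity) ?_)
      rw [div_div, div_le_iff₀ (by positivity)]
      have : ((k + 1 : ℕ) : ℝ) ≤ p := by exact_mod_cast hk.le
      push_cast at this
      nlinarith [Real.pi_pos]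
  have h2 : ∏ k ∈ Finset.range (2 * m), (2 * Real.sin (Real.pi * (k + 1) / p)) = p := by
    have := IsPrimitiveRoot.prod_one_sub_pow_eq_order (n := 2 * m) (μ := ζ) (by rwa [← hm])
    have h3 := congrArg norm this
    rw [norm_prod] at h3
    rw [← Finset.prod_congr rfl (fun k hk ↦ h1 k (by rw [Finset.mem_range] at hk; lia)), h3]
    rw [hm]
    have : ((2 * m : ℕ) : ℂ) + 1 = ((2 * m + 1 : ℕ) : ℂ) := by push_cast; ring
    rw [this, Complex.norm_natCast]
  rw [two_mul, Finset.prod_range_add] at h2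
  refine Eq.trans ?_ h2
  rw [sq]
  congr 1
  rw [← Finset.prod_range_reflect]
  refine Finset.prod_congr rfl fun k hk ↦ ?_
  rw [Finset.mem_range] at hk
  rw [← Real.sin_pi_sub]
  congr 2
  have hpR : (p : ℝ) ≠ 0 := by exact_mod_cast hp0
  rw [eq_div_iff hpR, sub_mul, div_mul_cancel₀ _ hpR, Nat.cast_sub (by lia), Nat.cast_sub (by lia),
    hm]
  push_cast
  ring

/-- The Legendre symbol modulo `p` as a complex Dirichlet character. -/
noncomputable def legendreChar (p : ℕ) [Fact p.Prime] : DirichletCharacter ℂ p :=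
  (quadraticChar (ZMod p)).ringHomComp (Int.castRingHom ℂ)

lemma legendreChar_intCast (p : ℕ) [Fact p.Prime] (n : ℤ) :
    legendreChar p n = (legendreSym p n : ℂ) := rfl

lemma legendreChar_natCast (p : ℕ) [Fact p.Prime] (n : ℕ) :
    legendreChar p n = (legendreSym p n : ℂ) := by
  rw [← legendreChar_intCast]; simp

lemma legendreChar_ne_one (p : ℕ) [Fact p.Prime] (hp : p ≠ 2) : legendreChar p ≠ 1 := by
  have h := quadraticChar_ne_one (F := ZMod p) (by rwa [ZMod.ringChar_zmod_n])
  rwa [Ne, legendreChar, MulChar.ringHomComp_eq_one_iff (RingHom.injective_int _)]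

lemma legendreChar_isQuadratic (p : ℕ) [Fact p.Prime] : (legendreChar p).IsQuadratic :=
  (quadraticChar_isQuadratic (ZMod p)).comp _

lemma legendreChar_neg_one (p : ℕ) [Fact p.Prime] (hp4 : p % 4 = 3) :
    legendreChar p (-1) = -1 := by
  have := legendreChar_intCast p (-1)
  rw [legendreSym.at_neg_one (by lia), ZMod.χ₄_nat_three_mod_four hp4] at this
  simpa using this

open Complex in
/-- **Gauss**: the sign of the quadratic Gauss sum for a prime `p ≡ 3 mod 4`. -/
lemma legendre_gaussSum_eq (p : ℕ) [Fact p.Prime] (hp4 : p % 4 = 3) :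
    gaussSum (legendreChar p) ZMod.stdAddChar = I * √p := by
  have hp : p.Prime := Fact.out
  obtain ⟨t, ht⟩ : ∃ t, p = 4 * t + 3 := ⟨p / 4, by lia⟩
  obtain ⟨m, hmt⟩ : ∃ m, m = 2 * t + 1 := ⟨_, rfl⟩
  have hm : p = 2 * m + 1 := by lia
  have hodd : Odd m := ⟨t, hmt⟩
  have hpC : (p : ℂ) ≠ 0 := by exact_mod_cast hp.ne_zero
  set η : ℂ := -exp (Real.pi * I / p) with hη
  set ζ : ℂ := exp (2 * Real.pi * I / p) with hζ
  have hζp : IsPrimitiveRoot ζ p := Complex.isPrimitiveRoot_exp p hp.ne_zero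
  have hηζ : η ^ 2 = ζ := by
    rw [hη, hζ, neg_sq, ← exp_nat_mul]; congr 1; push_cast; ring
  have hηp1 : η ^ p = 1 := by
    rw [hη, (show Odd p by exact ⟨m, hm⟩).neg_pow, ← exp_nat_mul, mul_div_cancel₀ _ hpC,
      exp_pi_mul_I]; norm_num
  have hηp : IsPrimitiveRoot η p := by
    have : η = ζ ^ (m + 1) := by
      rw [← hηζ, ← pow_mul, show 2 * (m + 1) = p + 1 by lia, pow_succ, hηp1, one_mul]
    rw [this]
    refine hζp.pow_of_coprime _ ?_
    rw [hm]
    have : Nat.Coprime (m+1) (2 * (m + 1) - 1) := by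
      rw [Nat.coprime_comm, ← Nat.isCoprime_iff_coprime]
      refine ⟨-1, 2, ?_⟩
      rw [Nat.cast_sub (by lia)]; push_cast; ring
    convert this using 1
    lia
  set R : ℝ := ∏ k ∈ Finset.range m, (2 * Real.sin (Real.pi * (k + 1) / p)) with hR
  have hR2 : R ^ 2 = p := prod_sin_sq p m hm
  have hR0 : 0 < R := by
    refine Finset.prod_pos fun k hk ↦ mul_pos two_pos (Real.sin_pos_of_pos_of_lt_pi ?_ ?_)
    · have := hp.pos; have := Real.pi_pos; positivity
    · rw [Finset.mem_range] at hk
      rw [div_lt_iff₀ (by exact_mod_cast hp.pos)]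
      have : ((k + 1 : ℕ) : ℝ) < p := by exact_mod_cast (by lia)
      push_cast at this
      nlinarith [Real.pi_pos]
  have hRs : R = √p := by rw [← hR2, Real.sqrt_sq hR0.le]
  have hB : ∏ k ∈ Finset.range m, (η ^ (k + 1) - η ^ (p - (k + 1))) = - I * R := by
    have h1 : ∀ k ∈ Finset.range m, η ^ (k + 1) - η ^ (p - (k + 1)) =
        ((-1) ^ (k + 1) * I) * ((2 * Real.sin (Real.pi * (k + 1) / p) : ℝ) : ℂ) := by
      intro k hk
      rw [Finset.mem_range] at hk
      have hη0 : η ^ (k + 1) ≠ 0 := pow_ne_zero _ (hηp.ne_zero hp.ne_zero)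
      have h2 : η ^ (p - (k + 1)) = (η ^ (k + 1))⁻¹ := by
        exact eq_inv_of_mul_eq_one_left (by rw [← pow_add, Nat.sub_add_cancel (by lia), hηp1])
      have h3 : η ^ (k + 1) = (-1) ^ (k + 1) * exp ((Real.pi * (k + 1) / p : ℝ) * I) := by
        rw [hη, neg_pow, ← exp_nat_mul]; congr 2; push_cast; ring
      rw [h2, h3, mul_inv, ← exp_neg, ← neg_mul, ← inv_pow, inv_neg, inv_one]
      push_cast
      rw [Complex.sin]
      linear_combination ((-1) ^ k * (exp (-(↑Real.pi * (↑k + 1) / ↑p) * I) -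
        exp (↑Real.pi * (↑k + 1) / ↑p * I))) * I_sq
    have h2 : ∏ k ∈ Finset.range m, ((-1) ^ (k + 1) * I) = -I := by
      rw [hmt]
      clear * -
      induction t with
      | zero => simp
      | succ t ih =>
        rw [show 2 * (t + 1) + 1 = 2 * t + 1 + 1 + 1 by ring, Finset.prod_range_succ,
          Finset.prod_range_succ, ih]
        have h : ((-1 : ℂ) ^ t) ^ 2 = 1 := by rw [← pow_mul, mul_comm, pow_mul]; norm_num
        have h4 : ((-1 : ℂ) ^ t) ^ 4 = 1 := by rw [← pow_mul, mul_comm, pow_mul]; norm_num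
        linear_combination (I * I ^ 2) * h4 + I * I_sq
    rw [Finset.prod_congr rfl h1, Finset.prod_mul_distrib, h2, ← Complex.ofReal_prod, ← hR]
  set χ := legendreChar p with hχ
  set ψ : AddChar (ZMod p) ℂ := ZMod.stdAddChar with hψ
  have hηψ : ∀ j : ℕ, η ^ j = ψ.mulShift ((m + 1 : ℕ) : ZMod p) (j : ZMod p) := by
    intro j
    have : η = ζ ^ (m + 1) := by
      rw [← hηζ, ← pow_mul, show 2 * (m + 1) = p + 1 by lia, pow_succ, hηp1, one_mul]
    rw [AddChar.mulShift_apply, this, ← Nat.cast_mul, ← pow_mul, hψ]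
    have := ZMod.stdAddChar_coe (N := p) (((m + 1) * j : ℕ) : ℤ)
    rw [Int.cast_natCast] at this
    rw [this, hζ, ← exp_nat_mul]
    congr 1
    push_cast
    ring
  have hA : ∑ j ∈ Finset.range p, (legendreSym p j : ℂ) * η ^ j =
      gaussSum χ (ψ.mulShift ((m + 1 : ℕ) : ZMod p)) := by
    rw [gaussSum, ← ZMod.sum_range_cast p]
    refine Finset.sum_congr rfl fun j _ ↦ ?_
    rw [hηψ, hχ, legendreChar_natCast]
  have h2m : (2 : ZMod p) * ((m + 1 : ℕ) : ZMod p) = 1 := by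
    have : ((p + 1 : ℕ) : ZMod p) = 1 := by simp
    rw [← this, show p + 1 = 2 * (m + 1) by lia]; push_cast; ring
  have hu : IsUnit ((m + 1 : ℕ) : ZMod p) := IsUnit.of_mul_eq_one_right _ h2m
  have hshift := gaussSum_mulShift χ ψ hu.unit
  rw [IsUnit.unit_spec] at hshift
  have hχ2 : χ 2 * χ ((m + 1 : ℕ) : ZMod p) = 1 := by rw [← map_mul, h2m, map_one]
  have hsq : gaussSum χ ψ ^ 2 = -p := by
    rw [gaussSum_sq (legendreChar_ne_one p (by lia)) (legendreChar_isQuadratic p)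
      (ZMod.isPrimitive_stdAddChar p), legendreChar_neg_one p hp4, ZMod.card]
    ring
  set G := gaussSum χ (ψ.mulShift ((m + 1 : ℕ) : ZMod p)) with hG
  have hGs : G = χ 2 * gaussSum χ ψ := by rw [← hshift, ← mul_assoc, hχ2, one_mul]
  obtain ⟨c, hc, hcχ⟩ : ∃ c : ℤ, c = legendreSym p 2 ∧ (χ 2 : ℂ) = c := by
    refine ⟨_, rfl, ?_⟩
    have := legendreChar_natCast p 2
    simpa using this
  have hc2 : c = 1 ∨ c = -1 := by
    rw [hc]
    refine legendreSym.eq_one_or_neg_one p ?_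
    intro h0
    rw [show ((2 : ℤ) : ZMod p) = 2 by norm_num] at h0
    rw [h0, zero_mul] at h2m
    exact zero_ne_one h2m
  have hccC : (c : ℂ) * c = 1 := by rcases hc2 with h | h <;> simp [h]
  have hsq2 : G ^ 2 = (-I * R) ^ 2 := by
    rw [hGs, hcχ, mul_pow, hsq, mul_pow, neg_sq, I_sq, ← ofReal_pow, hR2, sq, hccC]
    push_cast; ring
  obtain ⟨ε, hε, hGε⟩ : ∃ ε : ℤ, (ε = 1 ∨ ε = -1) ∧ G = ε * (-I * R) := by
    rcases sq_eq_sq_iff_eq_or_eq_neg.mp hsq2 with h | h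
    · exact ⟨1, Or.inl rfl, by rw [h]; simp⟩
    · exact ⟨-1, Or.inr rfl, by rw [h]; simp⟩
  have hmod := legendre_sum_eq_mul_prod_mod p m hm (by lia) hηp ε (by rw [hA, hB, hGε])
  rw [ZMod.factorial_half_sq p m hm hodd, mul_one] at hmod
  have hcp : (c : ZMod p) = 2 ^ m := by
    rw [hc, legendreSym.eq_pow, show p / 2 = m by lia]; norm_num
  rw [← hcp] at hmod
  have hdvd : (p : ℤ) ∣ ε * c + 1 := by
    rw [← ZMod.intCast_zmod_eq_zero_iff_dvd]
    push_cast
    rw [hmod]; ring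
  have hεc : ε * c = -1 := by
    rcases hε with h | h <;> rcases hc2 with h' | h' <;> rw [h, h'] at hdvd ⊢ <;> norm_num at hdvd ⊢
    all_goals
      have := Int.le_of_dvd (by norm_num) hdvd
      lia
  have hεcC : (ε : ℂ) * c = -1 := by exact_mod_cast hεc
  have : gaussSum χ ψ = c * G := by rw [hGs, hcχ, ← mul_assoc, hccC, one_mul]
  rw [this, hGε, hRs.symm]
  linear_combination (-I * R) * hεcC

open Filter Topology MeasureTheory Asymptotics in
lemma tendsto_sum_inv_mul_of_bounded {c : ℕ → ℂ} (hc0 : c 0 = 0) {C : ℝ}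
    (hC : ∀ n, ‖∑ k ∈ Finset.Icc 1 n, c k‖ ≤ C) :
    Tendsto (fun n : ℕ ↦ ∑ k ∈ Finset.Icc 0 n, (k : ℂ)⁻¹ * c k) atTop
      (𝓝 (∫ t in Set.Ioi (1 : ℝ), (∑ k ∈ Finset.Icc 1 ⌊t⌋₊, c k) * (t : ℂ) ^ (-2 : ℂ))) := by
  have h0 : ∀ n, ∑ k ∈ Finset.Icc 0 n, c k = ∑ k ∈ Finset.Icc 1 n, c k := fun n ↦ by
    rw [← Finset.insert_Icc_add_one_left_eq_Icc n.zero_le, Finset.sum_insert (by simp), hc0,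
      zero_add, zero_add]
  have hder : ∀ t : ℝ, t ≠ 0 → HasDerivAt (fun t : ℝ ↦ (t : ℂ)⁻¹) (-((t : ℂ) ^ 2)⁻¹) t := by
    intro t ht
    have := (hasDerivAt_inv (x := (t : ℂ)) (by exact_mod_cast ht)).comp_ofReal
    simpa using this
  have hcont : ContinuousOn (fun t : ℝ ↦ -((t : ℂ) ^ 2)⁻¹) (Set.Ici 1) := by
    refine ContinuousOn.neg (ContinuousOn.inv₀ (by fun_prop) fun t ht ↦ ?_)
    have : t ≠ 0 := by have : (1 : ℝ) ≤ t := ht; positivity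
    simpa using this
  have hcong : Set.EqOn (deriv fun t : ℝ ↦ (t : ℂ)⁻¹) (fun t : ℝ ↦ -((t : ℂ) ^ 2)⁻¹) (Set.Ici 1) :=
    fun t ht ↦ (hder t (by have : (1 : ℝ) ≤ t := ht; positivity)).deriv
  have key := tendsto_sum_mul_atTop_nhds_one_sub_integral₀ (𝕜 := ℂ) (f := fun t : ℝ ↦ (t : ℂ)⁻¹)
    (c := c) hc0 (l := 0) (g := fun t ↦ t ^ (-2 : ℝ))
    (fun t ht ↦ (hder t (by have : (1 : ℝ) ≤ t := ht; positivity)).differentiableAt)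
    ((hcont.congr hcong).locallyIntegrableOn measurableSet_Ici) ?_ ?_ ?_
  · convert! key using 2
    · rw [zero_sub, ← integral_neg]
      refine setIntegral_congr_fun measurableSet_Ioi fun t ht ↦ ?_
      have ht' : (1 : ℝ) < t := ht
      simp only [hcong (Set.mem_Ici.mpr ht'.le), h0]
      rw [Complex.cpow_neg, show (2 : ℂ) = ((2 : ℕ) : ℂ) by norm_num, Complex.cpow_natCast]
      ring
  · rw [tendsto_zero_iff_norm_tendsto_zero]
    refine squeeze_zero (fun _ ↦ norm_nonneg _) (g := fun n : ℕ ↦ (n : ℝ)⁻¹ * C) (fun n ↦ ?_) ?_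
    · rw [norm_mul, h0]
      simp only [norm_inv, Complex.ofReal_natCast, Complex.norm_natCast]
      gcongr
      exact hC n
    · simpa using (tendsto_inv_atTop_nhds_zero_nat (𝕜 := ℝ)).mul_const C
  · refine IsBigO.of_bound C ?_
    filter_upwards [eventually_ge_atTop 1] with t ht
    rw [norm_mul, hcong (Set.mem_Ici.mpr ht), h0, mul_comm]
    refine mul_le_mul (hC _) (le_of_eq ?_) (norm_nonneg _) ((norm_nonneg _).trans (hC 0))
    rw [norm_neg, norm_inv, norm_pow, Complex.norm_real, Real.norm_of_nonneg (by positivity),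
      Real.norm_of_nonneg (by positivity), Real.rpow_neg (by positivity)]
    norm_cast
  · exact ⟨Set.Ioi 1, Ioi_mem_atTop 1, integrableOn_Ioi_rpow_of_lt (by norm_num) one_pos⟩

open Filter Topology MeasureTheory Asymptotics in
lemma tendsto_LSeries_of_bounded {c : ℕ → ℂ} {C : ℝ}
    (hC : ∀ n, ‖∑ k ∈ Finset.Icc 1 n, c k‖ ≤ C) (hS : ∀ s : ℝ, 1 < s → LSeriesSummable c s) :
    Tendsto (fun s : ℝ ↦ LSeries c s) (𝓝[>] 1)
      (𝓝 (∫ t in Set.Ioi (1 : ℝ), (∑ k ∈ Finset.Icc 1 ⌊t⌋₊, c k) * (t : ℂ) ^ (-2 : ℂ))) := by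
  have hO : (fun n ↦ ∑ k ∈ Finset.Icc 1 n, c k) =O[atTop] fun n ↦ (n : ℝ) ^ (0 : ℝ) :=
    IsBigO.of_bound C (Eventually.of_forall fun n ↦ by simpa using hC n)
  have heq : ∀ᶠ s : ℝ in 𝓝[>] 1, (s : ℂ) * ∫ t in Set.Ioi (1 : ℝ),
      (∑ k ∈ Finset.Icc 1 ⌊t⌋₊, c k) * (t : ℂ) ^ (-((s : ℂ) + 1)) = LSeries c s := by
    filter_upwards [self_mem_nhdsWithin] with s hs
    have hs' : (1 : ℝ) < s := hs
    exact (LSeries_eq_mul_integral c le_rfl (by simpa using zero_lt_one.trans hs') (hS s hs) hO).symm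
  refine Tendsto.congr' heq ?_
  rw [← one_mul (∫ t in Set.Ioi (1 : ℝ), _)]
  refine Tendsto.mul ?_ ?_
  · have : Tendsto (fun s : ℝ ↦ (s : ℂ)) (𝓝 1) (𝓝 ((1 : ℝ) : ℂ)) :=
      Complex.continuous_ofReal.tendsto 1
    simpa using this.mono_left nhdsWithin_le_nhds
  · refine tendsto_integral_filter_of_dominated_convergence (fun t ↦ C * t ^ (-2 : ℝ)) ?_ ?_ ?_ ?_
    · refine Eventually.of_forall fun s ↦ ?_
      refine Measurable.aestronglyMeasurable ?_
      refine Measurable.mul ?_ (by fun_prop)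
      exact (measurable_from_nat (f := fun n ↦ ∑ k ∈ Finset.Icc 1 n, c k)).comp Nat.measurable_floor
    · filter_upwards [self_mem_nhdsWithin] with s hs
      refine (ae_restrict_iff' measurableSet_Ioi).mpr (ae_of_all _ fun t ht ↦ ?_)
      have hs' : (1 : ℝ) < s := hs
      have ht' : (1 : ℝ) < t := ht
      rw [norm_mul]
      refine mul_le_mul (hC _) ?_ (norm_nonneg _) ((norm_nonneg _).trans (hC 0))
      rw [Complex.norm_cpow_eq_rpow_re_of_pos (by linarith)]
      refine Real.rpow_le_rpow_of_exponent_le ht'.le ?_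
      simp; linarith
    · exact (integrableOn_Ioi_rpow_of_lt (by norm_num) one_pos).const_mul C
    · refine (ae_restrict_iff' measurableSet_Ioi).mpr (ae_of_all _ fun t ht ↦ ?_)
      have ht' : (1 : ℝ) < t := ht
      refine Tendsto.const_mul _ ?_
      have hc : Continuous fun s : ℝ ↦ (t : ℂ) ^ (-((s : ℂ) + 1)) := by
        refine Continuous.const_cpow (by fun_prop) (Or.inl ?_)
        exact_mod_cast (by linarith : t ≠ 0)
      have := (hc.tendsto 1).mono_left (nhdsWithin_le_nhds (s := Set.Ioi 1))
      convert this using 2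
      norm_num

lemma legendreChar_sum_eq_zero (p : ℕ) [Fact p.Prime] (hp : p ≠ 2) :
    ∑ x : ZMod p, legendreChar p x = 0 :=
  MulChar.sum_eq_zero_of_ne_one (legendreChar_ne_one p hp)

lemma norm_legendreChar_le (p : ℕ) [Fact p.Prime] (x : ZMod p) : ‖legendreChar p x‖ ≤ 1 :=
  DirichletCharacter.norm_le_one _ x

lemma norm_sum_legendreChar_le (p : ℕ) [Fact p.Prime] (hp : p ≠ 2) (n : ℕ) :
    ‖∑ k ∈ Finset.Icc 1 n, legendreChar p k‖ ≤ p := by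
  have hp' : p.Prime := Fact.out
  set F : ℕ → ℂ := fun n ↦ ∑ k ∈ Finset.range n, legendreChar p k with hF
  have hper : Function.Periodic F p := by
    intro n
    induction n with
    | zero => simp [hF, ZMod.sum_range_cast p (fun x ↦ legendreChar p x),
        legendreChar_sum_eq_zero p hp]
    | succ n ih =>
      simp only [hF] at ih ⊢
      rw [show n + 1 + p = n + p + 1 by ring, Finset.sum_range_succ, ih, Finset.sum_range_succ]
      simp
  have h1 : ∑ k ∈ Finset.Icc 1 n, legendreChar p k = F (n + 1) := by
    simp only [hF]
    rw [Finset.sum_range_succ', Nat.cast_zero, MulChar.map_nonunit _ not_isUnit_zero, add_zero,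
      Finset.range_eq_Ico, Finset.sum_Ico_add' (fun k : ℕ ↦ legendreChar p k) 0 n 1]
    rfl
  rw [h1, ← hper.map_mod_nat]
  refine (norm_sum_le_of_le _ fun (k : ℕ) _ ↦ norm_legendreChar_le p (k : ZMod p)).trans ?_
  simp only [Finset.sum_const, Finset.card_range, nsmul_eq_mul, mul_one]
  exact_mod_cast (Nat.mod_lt _ hp'.pos).le

open Complex in
lemma log_one_sub_exp {θ : ℝ} (h0 : 0 < θ) (h1 : θ < 1) :
    log (1 - exp (2 * Real.pi * I * θ)) =
      Real.log (2 * Real.sin (Real.pi * θ)) + (Real.pi * θ - Real.pi / 2 : ℝ) * I := by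
  have hs : 0 < 2 * Real.sin (Real.pi * θ) :=
    mul_pos two_pos (Real.sin_pos_of_pos_of_lt_pi (by positivity) (by nlinarith [Real.pi_pos]))
  have : 1 - exp (2 * Real.pi * I * θ) =
      ((2 * Real.sin (Real.pi * θ) : ℝ) : ℂ) * exp ((Real.pi * θ - Real.pi / 2 : ℝ) * I) := by
    have h3 : exp ((Real.pi * θ - Real.pi / 2 : ℝ) * I) = exp (Real.pi * θ * I) * (-I) := by
      push_cast
      rw [sub_mul, Complex.exp_sub, Complex.exp_pi_div_two_mul_I, div_I]; ring
    rw [h3, show 2 * (Real.pi : ℂ) * I * θ = Real.pi * θ * I + Real.pi * θ * I by ring,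
      Complex.exp_add]
    push_cast
    rw [Complex.sin]
    have h4 : exp (-(Real.pi * θ) * I) * exp (Real.pi * θ * I) = 1 := by
      rw [← Complex.exp_add]; simp
    linear_combination (-1 : ℂ) * h4 + (1 * exp (-(Real.pi * θ) * I) * exp (Real.pi * θ * I) -
      exp (Real.pi * θ * I) * exp (Real.pi * θ * I)) * I_sq
  rw [this, Complex.log_ofReal_mul hs (exp_ne_zero _), Complex.log_exp]
  · simp; nlinarith [Real.pi_pos]
  · simp; nlinarith [Real.pi_pos]

lemma ZMod.sum_eq_zero_of_odd {p : ℕ} [NeZero p] (f : ZMod p → ℂ) (hf : ∀ x, f (-x) = -f x) :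
    ∑ x, f x = 0 := by
  have : ∑ x, f x = - ∑ x, f x := by
    conv_lhs => rw [← Equiv.sum_comp (Equiv.neg _)]
    simp [hf]
  linear_combination this / 2

open Complex in
lemma legendreChar_sum_log (p : ℕ) [Fact p.Prime] (hp4 : p % 4 = 3) :
    ∑ x : ZMod p, legendreChar p x * log (1 - ZMod.stdAddChar x) =
      (Real.pi / p) * I * ∑ x : ZMod p, legendreChar p x * x.val := by
  have hp : p.Prime := Fact.out
  have hp0 : (p : ℝ) ≠ 0 := by exact_mod_cast hp.ne_zero
  have h1 : ∀ x : ZMod p, legendreChar p x * log (1 - ZMod.stdAddChar x) =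
      legendreChar p x * Real.log (2 * Real.sin (Real.pi * (x.val / p))) +
      (-(Real.pi / 2) * I * legendreChar p x + (Real.pi / p) * I * (legendreChar p x * x.val)) := by
    intro x
    rcases eq_or_ne x 0 with rfl | hx
    · rw [MulChar.map_nonunit _ not_isUnit_zero]; simp
    have hv0 : 0 < x.val := Nat.pos_of_ne_zero fun h ↦ hx ((ZMod.val_eq_zero x).mp h)
    have hv1 : (x.val : ℝ) < p := by exact_mod_cast ZMod.val_lt x
    have hpp : (0 : ℝ) < p := by exact_mod_cast hp.pos
    have : (ZMod.stdAddChar x : ℂ) = exp (2 * Real.pi * I * ((x.val / p : ℝ) : ℂ)) := by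
      have := ZMod.stdAddChar_coe (N := p) (x.val : ℤ)
      rw [Int.cast_natCast, ZMod.natCast_zmod_val] at this
      rw [this]; congr 1; push_cast; ring
    rw [this, log_one_sub_exp (by positivity) ((div_lt_one hpp).mpr hv1)]
    push_cast
    ring
  simp only [h1, Finset.sum_add_distrib, ← Finset.mul_sum]
  rw [legendreChar_sum_eq_zero p (by lia), ZMod.sum_eq_zero_of_odd]
  · ring
  · intro x
    rcases eq_or_ne x 0 with rfl | hx
    · rw [neg_zero, MulChar.map_nonunit _ not_isUnit_zero]; simp
    have : NeZero x := ⟨hx⟩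
    rw [← neg_one_mul x, map_mul, legendreChar_neg_one p hp4, neg_one_mul, neg_one_mul,
      ZMod.val_neg_of_ne_zero, Nat.cast_sub (ZMod.val_lt x).le, sub_div, div_self hp0, mul_sub,
      mul_one, Real.sin_pi_sub]
    ring

lemma gaussSum_mul_legendreChar (p : ℕ) [Fact p.Prime] (hp : p ≠ 2) (n : ℕ) :
    gaussSum (legendreChar p) ZMod.stdAddChar * legendreChar p n =
      ∑ x : ZMod p, legendreChar p x * ZMod.stdAddChar x ^ n := by
  have h1 : ∑ x : ZMod p, legendreChar p x * ZMod.stdAddChar x ^ n =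
      gaussSum (legendreChar p) (AddChar.mulShift ZMod.stdAddChar (n : ZMod p)) := by
    refine Finset.sum_congr rfl fun x _ ↦ ?_
    rw [AddChar.mulShift_apply, ← AddChar.map_nsmul_eq_pow, nsmul_eq_mul]
  rw [h1]
  by_cases hn : (n : ZMod p) = 0
  · rw [hn, MulChar.map_nonunit _ not_isUnit_zero, mul_zero, gaussSum]
    simp [legendreChar_sum_eq_zero p hp]
  · have hu : IsUnit (n : ZMod p) := isUnit_iff_ne_zero.mpr hn
    have := gaussSum_mulShift (legendreChar p) ZMod.stdAddChar hu.unit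
    rw [IsUnit.unit_spec] at this
    have h2 : legendreChar p n * legendreChar p n = 1 := by
      rcases legendreChar_isQuadratic p n with h | h | h
      · exact absurd h ((hu.map _).ne_zero)
      · rw [h, one_mul]
      · rw [h]; norm_num
    rw [← this]
    linear_combination gaussSum (legendreChar p) (AddChar.mulShift ZMod.stdAddChar (n : ZMod p)) * h2

open Complex Filter Topology in
lemma tendsto_legendre_powerSeries (p : ℕ) [Fact p.Prime] (hp4 : p % 4 = 3) :
    Tendsto (fun x : ℝ ↦ gaussSum (legendreChar p) ZMod.stdAddChar *
      ∑' n : ℕ, (n : ℂ)⁻¹ * legendreChar p n * (x : ℂ) ^ n) (𝓝[<] 1)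
      (𝓝 (-((Real.pi / p) * I * ∑ x : ZMod p, legendreChar p x * x.val))) := by
  have hp2 : p ≠ 2 := by lia
  rw [← legendreChar_sum_log p hp4]
  have heq : ∀ᶠ x : ℝ in 𝓝[<] 1, -∑ a : ZMod p, legendreChar p a *
      log (1 - ZMod.stdAddChar a * x) = gaussSum (legendreChar p) ZMod.stdAddChar *
      ∑' n : ℕ, (n : ℂ)⁻¹ * legendreChar p n * (x : ℂ) ^ n := by
    have : ∀ᶠ x : ℝ in 𝓝[<] 1, x ∈ Set.Ioo 0 1 := Ioo_mem_nhdsLT one_pos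
    filter_upwards [this] with x hx
    have h1 : ∀ a : ZMod p, HasSum (fun n : ℕ ↦ legendreChar p a *
        ((ZMod.stdAddChar a * (x : ℂ)) ^ n / n))
        (legendreChar p a * -log (1 - ZMod.stdAddChar a * x)) := by
      intro a
      refine (Complex.hasSum_taylorSeries_neg_log ?_).mul_left _
      rw [norm_mul, AddChar.norm_apply, one_mul, Complex.norm_real, Real.norm_of_nonneg hx.1.le]
      exact hx.2
    have h2 := hasSum_sum (fun a (_ : a ∈ Finset.univ) ↦ h1 a)
    rw [← tsum_mul_left]
    refine Eq.symm (Eq.trans (tsum_congr fun n ↦ ?_) (h2.tsum_eq.trans ?_))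
    · rw [show gaussSum (legendreChar p) ZMod.stdAddChar * ((n : ℂ)⁻¹ * legendreChar p n * (x : ℂ) ^ n)
        = (gaussSum (legendreChar p) ZMod.stdAddChar * legendreChar p n) * ((n : ℂ)⁻¹ * x ^ n) by ring,
        gaussSum_mul_legendreChar p hp2, Finset.sum_mul]
      refine Finset.sum_congr rfl fun a _ ↦ ?_
      rw [mul_pow]; ring
    · simp
  refine Tendsto.congr' heq ?_
  refine Tendsto.neg (tendsto_finsetSum _ fun a _ ↦ ?_)
  rcases eq_or_ne a 0 with rfl | ha
  · rw [MulChar.map_nonunit _ not_isUnit_zero]; simp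
  refine Tendsto.const_mul _ (Tendsto.clog ?_ ?_)
  · have : Continuous fun x : ℝ ↦ 1 - ZMod.stdAddChar a * (x : ℂ) := by fun_prop
    have := (this.tendsto 1).mono_left (nhdsWithin_le_nhds (s := Set.Iio 1))
    simpa using this
  · left
    have hne : (ZMod.stdAddChar a : ℂ) ≠ 1 := by
      rw [← AddChar.map_zero_eq_one (ZMod.stdAddChar (N := p))]
      exact fun h ↦ ha (ZMod.injective_stdAddChar h)
    have hn : ‖(ZMod.stdAddChar a : ℂ)‖ = 1 := AddChar.norm_apply _ _
    have hle := Complex.re_le_norm (ZMod.stdAddChar a : ℂ)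
    rw [hn] at hle
    rw [sub_re, one_re, sub_pos]
    refine lt_of_le_of_ne hle fun h ↦ hne ?_
    have : (ZMod.stdAddChar a : ℂ).im = 0 := by
      have := Complex.sq_norm (ZMod.stdAddChar a : ℂ)
      rw [hn, Complex.normSq_apply, h] at this
      nlinarith
    exact Complex.ext (by simpa using h) (by simpa using this)

lemma ZMod.sum_legendreChar_mul_val (p : ℕ) [Fact p.Prime] :
    ∑ x : ZMod p, legendreChar p x * x.val =
      ∑ a ∈ Finset.Icc 1 (p - 1), (legendreSym p a : ℂ) * a := by
  have hp : p.Prime := Fact.out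
  rw [← ZMod.sum_range_cast p]
  have : ∀ j ∈ Finset.range p, legendreChar p j * ((j : ZMod p).val : ℂ) =
      (legendreSym p j : ℂ) * j := by
    intro j hj
    rw [ZMod.val_cast_of_lt (Finset.mem_range.mp hj), legendreChar_natCast]
  rw [Finset.sum_congr rfl this]
  symm
  refine Finset.sum_subset ?_ ?_
  · intro a; simp; lia
  · intro a ha h
    have : a = 0 := by simp at ha h; lia
    simp [this]

open Filter Topology in
/-- The value at `s = 1` of the `L`-series of the Legendre symbol. -/
lemma tendsto_LSeries_legendreChar (p : ℕ) [Fact p.Prime] (hp4 : p % 4 = 3) :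
    Tendsto (fun s : ℝ ↦ LSeries (fun n ↦ legendreChar p n) s) (𝓝[>] 1)
      (𝓝 (-(Real.pi / (p * √p)) * ∑ a ∈ Finset.Icc 1 (p - 1), (legendreSym p a : ℂ) * a)) := by
  have hp : p.Prime := Fact.out
  have hp0 : (p : ℂ) ≠ 0 := by exact_mod_cast hp.ne_zero
  have hsp0 : ((√p : ℝ) : ℂ) ≠ 0 := by
    exact_mod_cast (Real.sqrt_pos.mpr (by exact_mod_cast hp.pos)).ne'
  have hC := norm_sum_legendreChar_le p (by lia)
  have h1 := tendsto_sum_inv_mul_of_bounded (c := fun n ↦ legendreChar p n)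
    (by simpa using MulChar.map_nonunit (legendreChar p) not_isUnit_zero) hC
  have h2 := tendsto_LSeries_of_bounded (c := fun n ↦ legendreChar p n) hC fun s hs ↦
    DirichletCharacter.LSeriesSummable_of_one_lt_re _ (by simpa using hs)
  convert h2 using 2
  set l := ∫ t in Set.Ioi (1 : ℝ), (∑ k ∈ Finset.Icc 1 ⌊t⌋₊, legendreChar p k) * (t : ℂ) ^ (-2 : ℂ)
  have h3 : Tendsto (fun n : ℕ ↦ ∑ k ∈ Finset.range n, (k : ℂ)⁻¹ * legendreChar p k) atTop (𝓝 l) := by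
    rw [← tendsto_add_atTop_iff_nat 1]
    refine h1.congr fun n ↦ ?_
    rw [Finset.range_eq_Ico]; rfl
  have h4 := (Complex.tendsto_tsum_powerSeries_nhdsWithin_lt h3).comp tendsto_map
  have h5 := tendsto_nhds_unique (h4.const_mul (gaussSum (legendreChar p) ZMod.stdAddChar))
    (tendsto_legendre_powerSeries p hp4)
  rw [legendre_gaussSum_eq p hp4, ZMod.sum_legendreChar_mul_val] at h5
  field_simp at h5 ⊢
  linear_combination -h5

section IdealCount

variable {R : Type*} [CommRing R] [IsDedekindDomain R] [Module.Free ℤ R]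

lemma Ideal.dvd_span_absNorm (I : Ideal R) {n : ℕ} (h : Ideal.absNorm I = n) :
    I ∣ Ideal.span {(n : R)} := by
  rw [Ideal.dvd_span_singleton, ← h]
  exact Ideal.absNorm_mem I

lemma Ideal.isCoprime_of_coprime_absNorm {I J : Ideal R}
    (h : Nat.Coprime (Ideal.absNorm I) (Ideal.absNorm J)) : IsCoprime I J := by
  rw [Ideal.isCoprime_iff_exists]
  obtain ⟨a, b, hab⟩ := Nat.isCoprime_iff_coprime.mpr h
  refine ⟨a * (Ideal.absNorm I : R), I.mul_mem_left _ (Ideal.absNorm_mem I),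
    b * (Ideal.absNorm J : R), J.mul_mem_left _ (Ideal.absNorm_mem J), ?_⟩
  exact_mod_cast congrArg (Int.cast : ℤ → R) hab

lemma Ideal.card_absNorm_one : Nat.card {I : Ideal R // Ideal.absNorm I = 1} = 1 := by
  simp only [Ideal.absNorm_eq_one_iff]
  simp

lemma Ideal.card_absNorm_prime_pow_of_ramified {q : ℕ} (hq : q.Prime) {P : Ideal R}
    (hP : Ideal.absNorm P = q) (hPq : Ideal.span {(q : R)} = P ^ 2) (k : ℕ) :
    Nat.card {I : Ideal R // Ideal.absNorm I = q ^ k} = 1 := by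
  have hprime : Prime P := by
    refine Ideal.prime_of_isPrime ?_ (Ideal.isPrime_of_irreducible_absNorm (hP ▸ hq))
    rintro rfl
    rw [Ideal.absNorm_bot] at hP
    exact hq.ne_zero hP.symm
  rw [Nat.card_eq_one_iff_exists]
  refine ⟨⟨P ^ k, by rw [map_pow, hP]⟩, ?_⟩
  rintro ⟨I, hI⟩
  have hd := I.dvd_span_absNorm hI
  rw [Nat.cast_pow, ← Ideal.span_singleton_pow, hPq, ← pow_mul, dvd_prime_pow hprime] at hd
  obtain ⟨i, -, hi⟩ := hd
  rw [associated_iff_eq] at hi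
  subst hi
  refine Subtype.ext ?_
  rw [map_pow, hP] at hI
  simp only [Nat.pow_right_injective hq.two_le hI]

lemma Ideal.card_absNorm_prime_pow_of_inert {q : ℕ} (hq : q.Prime)
    (hQ : Prime (Ideal.span {(q : R)})) (hn : Ideal.absNorm (Ideal.span {(q : R)}) = q ^ 2)
    (k : ℕ) :
    Nat.card {I : Ideal R // Ideal.absNorm I = q ^ k} = if Even k then 1 else 0 := by
  have key : ∀ I : Ideal R, Ideal.absNorm I = q ^ k →
      ∃ i, I = Ideal.span {(q : R)} ^ i ∧ k = 2 * i := by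
    intro I hI
    have hd := I.dvd_span_absNorm hI
    rw [Nat.cast_pow, ← Ideal.span_singleton_pow, dvd_prime_pow hQ] at hd
    obtain ⟨i, -, hi⟩ := hd
    rw [associated_iff_eq] at hi
    subst hi
    rw [map_pow, hn, ← pow_mul] at hI
    exact ⟨i, rfl, (Nat.pow_right_injective hq.two_le hI).symm⟩
  split_ifs with hk
  · obtain ⟨j, rfl⟩ := hk
    rw [Nat.card_eq_one_iff_exists]
    refine ⟨⟨Ideal.span {(q : R)} ^ j, by rw [map_pow, hn, ← pow_mul, two_mul]⟩, ?_⟩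
    rintro ⟨I, hI⟩
    obtain ⟨i, rfl, hi⟩ := key I hI
    obtain rfl : i = j := by lia
    rfl
  · rw [Nat.card_eq_zero]
    refine Or.inl ⟨?_⟩
    rintro ⟨I, hI⟩
    obtain ⟨i, -, rfl⟩ := key I hI
    exact hk (even_two_mul i)

lemma Ideal.card_absNorm_prime_pow_of_split {q : ℕ} (hq : q.Prime) {P P' : Ideal R}
    (hP : Ideal.absNorm P = q) (hP' : Ideal.absNorm P' = q)
    (hPq : Ideal.span {(q : R)} = P * P') (hne : P ≠ P') (k : ℕ) :
    Nat.card {I : Ideal R // Ideal.absNorm I = q ^ k} = k + 1 := by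
  have hprime : ∀ P : Ideal R, Ideal.absNorm P = q → Prime P := by
    intro P hP
    refine Ideal.prime_of_isPrime ?_ (Ideal.isPrime_of_irreducible_absNorm (hP ▸ hq))
    rintro rfl
    rw [Ideal.absNorm_bot] at hP
    exact hq.ne_zero hP.symm
  have hp := hprime P hP
  have hp' := hprime P' hP'
  have hlt : ∀ i j i' j' : ℕ, P ^ i * P' ^ j = P ^ i' * P' ^ j' → ¬ i < i' := by
    intro i j i' j' h hii
    obtain ⟨d, rfl⟩ : ∃ d, i' = i + (d + 1) := ⟨i' - i - 1, by lia⟩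
    rw [pow_add, mul_assoc] at h
    have h2 := mul_left_cancel₀ (pow_ne_zero i hp.ne_zero) h
    have h3 : P ∣ P' ^ j := by
      rw [h2, pow_succ, mul_assoc]
      exact dvd_mul_of_dvd_right (dvd_mul_right _ _) _
    have h4 := hp.dvd_of_dvd_pow h3
    exact hne (associated_iff_eq.mp ((hp.dvd_prime_iff_associated hp').mp h4))
  rw [← Nat.card_fin (k + 1)]
  symm
  refine Nat.card_congr (Equiv.ofBijective (fun i : Fin (k + 1) ↦
    ⟨P ^ (i : ℕ) * P' ^ (k - i : ℕ), ?_⟩) ⟨?_, ?_⟩)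
  · rw [map_mul, map_pow, map_pow, hP, hP', ← pow_add, Nat.add_sub_cancel' (by lia)]
  · intro i j h
    have h' : P ^ (i : ℕ) * P' ^ (k - i : ℕ) = P ^ (j : ℕ) * P' ^ (k - j : ℕ) :=
      congrArg Subtype.val h
    have := hlt _ _ _ _ h'
    have := hlt _ _ _ _ h'.symm
    lia
  · rintro ⟨I, hI⟩
    have hd := I.dvd_span_absNorm hI
    rw [Nat.cast_pow, ← Ideal.span_singleton_pow, hPq, mul_pow] at hd
    obtain ⟨I₁, I₂, h₁, h₂, rfl⟩ := exists_dvd_and_dvd_of_dvd_mul hd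
    obtain ⟨i, -, hi⟩ := (dvd_prime_pow hp _).mp h₁
    obtain ⟨j, -, hj⟩ := (dvd_prime_pow hp' _).mp h₂
    rw [associated_iff_eq] at hi hj
    subst hi hj
    rw [map_mul, map_pow, map_pow, hP, hP', ← pow_add] at hI
    have hij := Nat.pow_right_injective hq.two_le hI
    refine ⟨⟨i, by lia⟩, Subtype.ext ?_⟩
    simp only
    rw [← hij, Nat.add_sub_cancel_left]

variable [Module.Finite ℤ R]

/-- Ideals of coprime norms `m` and `n` multiply to give all ideals of norm `m * n`, uniquely. -/
lemma Ideal.card_absNorm_mul {m n : ℕ} (hmn : Nat.Coprime m n) :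
    Nat.card {I : Ideal R // Ideal.absNorm I = m * n} =
      Nat.card {I : Ideal R // Ideal.absNorm I = m} *
        Nat.card {I : Ideal R // Ideal.absNorm I = n} := by
  rw [← Nat.card_prod]
  symm
  refine Nat.card_congr (Equiv.ofBijective
    (fun J ↦ ⟨J.1.1 * J.2.1, by rw [map_mul, J.1.2, J.2.2]⟩) ⟨?_, ?_⟩)
  · rintro ⟨⟨J₁, h₁⟩, ⟨J₂, h₂⟩⟩ ⟨⟨J₁', h₁'⟩, ⟨J₂', h₂'⟩⟩ h
    have h' : J₁ * J₂ = J₁' * J₂' := congrArg Subtype.val h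
    have c12 : IsCoprime J₁ J₂' := Ideal.isCoprime_of_coprime_absNorm (by rwa [h₁, h₂'])
    have c21 : IsCoprime J₁' J₂ := Ideal.isCoprime_of_coprime_absNorm (by rwa [h₁', h₂])
    have e1 : J₁ = J₁' := dvd_antisymm
      (c12.dvd_of_dvd_mul_right (h' ▸ dvd_mul_right _ _))
      (c21.dvd_of_dvd_mul_right (h' ▸ dvd_mul_right _ _))
    have e2 : J₂ = J₂' := dvd_antisymm
      (c21.symm.dvd_of_dvd_mul_left (h' ▸ dvd_mul_left _ _))
      (c12.symm.dvd_of_dvd_mul_left (h' ▸ dvd_mul_left _ _))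
    subst e1 e2
    rfl
  · rintro ⟨I, hI⟩
    have hd := I.dvd_span_absNorm hI
    rw [Nat.cast_mul, ← Ideal.span_singleton_mul_span_singleton] at hd
    obtain ⟨J₁, J₂, h₁, h₂, rfl⟩ := exists_dvd_and_dvd_of_dvd_mul hd
    rw [map_mul] at hI
    have d₁ := map_dvd Ideal.absNorm h₁
    have d₂ := map_dvd Ideal.absNorm h₂
    rw [Ideal.absNorm_span_natCast] at d₁ d₂
    have k₁ : Ideal.absNorm J₁ ∣ m :=
      ((hmn.pow_left _).coprime_dvd_left d₁).dvd_of_dvd_mul_right (hI ▸ dvd_mul_right _ _)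
    have k₂ : Ideal.absNorm J₂ ∣ n :=
      ((hmn.symm.pow_left _).coprime_dvd_left d₂).dvd_of_dvd_mul_left (hI ▸ dvd_mul_left _ _)
    have k₃ : m ∣ Ideal.absNorm J₁ :=
      ((hmn.symm.pow_left _).coprime_dvd_left d₂).symm.dvd_of_dvd_mul_right (hI ▸ dvd_mul_right _ _)
    have k₄ : n ∣ Ideal.absNorm J₂ :=
      ((hmn.pow_left _).coprime_dvd_left d₁).symm.dvd_of_dvd_mul_left (hI ▸ dvd_mul_left _ _)
    exact ⟨(⟨J₁, Nat.dvd_antisymm k₁ k₃⟩, ⟨J₂, Nat.dvd_antisymm k₂ k₄⟩), rfl⟩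

end IdealCount

section QuadraticOrder

variable {R : Type*} [CommRing R] [IsDedekindDomain R] [Module.Free ℤ R]

lemma Ideal.card_absNorm_prime_pow_of_sq_eq_neg (hfin : Module.finrank ℤ R = 2)
    {p : ℕ} (hp : p.Prime) {β : R} (hβ : β ^ 2 = -(p : R)) (k : ℕ) :
    Nat.card {I : Ideal R // Ideal.absNorm I = p ^ k} = 1 := by
  have : Module.Finite ℤ R := Module.finite_of_finrank_pos (by lia)
  have h : Ideal.span {(p : R)} = Ideal.span {β} ^ 2 := by
    rw [Ideal.span_singleton_pow, hβ, Ideal.span_singleton_neg]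
  refine Ideal.card_absNorm_prime_pow_of_ramified hp ?_ h k
  have h2 := congrArg Ideal.absNorm h
  rw [Ideal.absNorm_span_natCast, hfin, map_pow] at h2
  exact (Nat.pow_left_injective two_ne_zero h2).symm

lemma Nat.Prime.eq_of_sq_eq_mul {q a b : ℕ} (hq : q.Prime) (h : q ^ 2 = a * b) (ha : a ≠ 1)
    (hb : b ≠ 1) : a = q ∧ b = q := by
  obtain ⟨i, hi, rfl⟩ := (Nat.dvd_prime_pow hq).mp (Dvd.intro _ h.symm)
  obtain ⟨j, hj, rfl⟩ := (Nat.dvd_prime_pow hq).mp (Dvd.intro_left _ h.symm)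
  rw [← pow_add] at h
  have := Nat.pow_right_injective hq.two_le h
  have : i ≠ 0 := by rintro rfl; simp at ha
  have : j ≠ 0 := by rintro rfl; simp at hb
  obtain rfl : i = 1 := by lia
  obtain rfl : j = 1 := by lia
  simp

lemma Ideal.card_absNorm_prime_pow_of_root (hfin : Module.finrank ℤ R = 2)
    {q : ℕ} (hq : q.Prime) {θ : R} {c τ : ℤ} (hθ : θ ^ 2 = θ - c)
    (hinj : ∀ x y : ℤ, (x : R) + y * θ = 0 → x = 0 ∧ y = 0)
    (hspan : ∀ r : R, ∃ x y : ℤ, r = x + y * θ)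
    (hτ : (q : ℤ) ∣ τ ^ 2 - τ + c) (hτ2 : ¬ (q : ℤ) ∣ 2 * τ - 1) (k : ℕ) :
    Nat.card {I : Ideal R // Ideal.absNorm I = q ^ k} = k + 1 := by
  have : Module.Finite ℤ R := Module.finite_of_finrank_pos (by lia)
  obtain ⟨w, hw⟩ := hτ
  have hwR : (τ : R) ^ 2 - τ + c = q * w := by exact_mod_cast congrArg (Int.cast : ℤ → R) hw
  obtain ⟨a, b, hab⟩ : IsCoprime (q : ℤ) (2 * τ - 1) :=
    (Nat.prime_iff_prime_int.mp hq).irreducible.coprime_iff_not_dvd.mpr hτ2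
  have habR : (a : R) * q + b * (2 * τ - 1) = 1 := by
    exact_mod_cast congrArg (Int.cast : ℤ → R) hab
  set P := Ideal.span {(q : R), θ - τ} with hP
  set P' := Ideal.span {(q : R), θ - (1 - τ)} with hP'
  have hqP : (q : R) ∈ P := Ideal.subset_span (by simp)
  have hqP' : (q : R) ∈ P' := Ideal.subset_span (by simp)
  have hPt : θ - τ ∈ P := Ideal.subset_span (by simp)
  have hPt' : θ - (1 - τ) ∈ P' := Ideal.subset_span (by simp)
  have hmul : Ideal.span {(q : R)} = P * P' := by
    apply le_antisymm
    · rw [Ideal.span_singleton_le_iff_mem]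
      have h1 : (q : R) * q ∈ P * P' := Ideal.mul_mem_mul hqP hqP'
      have h2 : (θ - τ) * q ∈ P * P' := Ideal.mul_mem_mul hPt hqP'
      have h3 : q * (θ - (1 - τ)) ∈ P * P' := Ideal.mul_mem_mul hqP hPt'
      have : (q : R) = a * (q * q) + b * (q * (θ - (1 - τ)) - (θ - τ) * q) := by
        linear_combination (-(q : R)) * habR
      rw [this]
      exact add_mem (Ideal.mul_mem_left _ _ h1) (Ideal.mul_mem_left _ _ (sub_mem h3 h2))
    · rw [hP, hP', Ideal.span_pair_mul_span_pair, Ideal.span_le]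
      rintro x hx
      simp only [Set.mem_insert_iff, Set.mem_singleton_iff] at hx
      rw [SetLike.mem_coe, Ideal.mem_span_singleton]
      rcases hx with rfl | rfl | rfl | rfl
      · exact dvd_mul_right _ _
      · exact dvd_mul_right _ _
      · exact dvd_mul_left _ _
      · exact ⟨-w, by linear_combination hθ - hwR⟩
  have hnot : ∀ s : R, s ∈ Set.range (Int.cast : ℤ → R) → θ - s ∉ Ideal.span {(q : R)} := by
    rintro _ ⟨s, rfl⟩ h1
    rw [Ideal.mem_span_singleton] at h1
    obtain ⟨r, hr⟩ := h1
    obtain ⟨x, y, rfl⟩ := hspan r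
    obtain ⟨-, h2⟩ := hinj (s + q * x) (q * y - 1) (by push_cast; linear_combination -hr)
    exact (Nat.prime_iff_prime_int.mp hq).not_dvd_one ⟨y, by lia⟩
  have hP1 : P ≠ ⊤ := by
    intro h
    rw [h, Ideal.top_mul] at hmul
    exact hnot (1 - τ) ⟨1 - τ, by push_cast; rfl⟩ (hmul ▸ hPt')
  have hP1' : P' ≠ ⊤ := by
    intro h
    rw [h, Ideal.mul_top] at hmul
    exact hnot τ ⟨τ, rfl⟩ (hmul ▸ hPt)
  have hnorm := congrArg Ideal.absNorm hmul
  rw [Ideal.absNorm_span_natCast, hfin, map_mul] at hnorm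
  obtain ⟨hN, hN'⟩ := hq.eq_of_sq_eq_mul hnorm
    (mt Ideal.absNorm_eq_one_iff.mp hP1) (mt Ideal.absNorm_eq_one_iff.mp hP1')
  refine Ideal.card_absNorm_prime_pow_of_split hq hN hN' hmul (fun h ↦ hP1 ?_) k
  rw [Ideal.eq_top_iff_one, ← habR]
  refine add_mem (P.mul_mem_left _ hqP) (P.mul_mem_left _ ?_)
  have : (2 * τ - 1 : R) = (θ - (1 - τ)) - (θ - τ) := by ring
  rw [this]
  exact sub_mem (h ▸ hPt') hPt

lemma Ideal.card_absNorm_prime_pow_of_no_root (hfin : Module.finrank ℤ R = 2)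
    {q : ℕ} (hq : q.Prime) {θ : R} {c : ℤ} (hθ : θ ^ 2 = θ - c)
    (hτ : ∀ τ : ZMod q, τ ^ 2 - τ + c ≠ 0) (k : ℕ) :
    Nat.card {I : Ideal R // Ideal.absNorm I = q ^ k} = if Even k then 1 else 0 := by
  have : Module.Finite ℤ R := Module.finite_of_finrank_pos (by lia)
  have hn : Ideal.absNorm (Ideal.span {(q : R)}) = q ^ 2 := by
    rw [Ideal.absNorm_span_natCast, hfin]
  refine Ideal.card_absNorm_prime_pow_of_inert hq (Irreducible.prime ⟨?_, ?_⟩) hn k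
  · rw [Ideal.isUnit_iff]
    intro h
    rw [h, Ideal.absNorm_top] at hn
    exact hq.one_lt.ne' (by nlinarith [hq.one_lt])
  · intro I J hIJ
    by_contra! h
    rw [Ideal.isUnit_iff, Ideal.isUnit_iff] at h
    rw [hIJ, map_mul] at hn
    obtain ⟨hI, -⟩ := hq.eq_of_sq_eq_mul hn.symm
      (mt Ideal.absNorm_eq_one_iff.mp h.1) (mt Ideal.absNorm_eq_one_iff.mp h.2)
    rw [Ideal.absNorm_apply, Submodule.cardQuot_apply] at hI
    have : Finite (R ⧸ I) := Nat.finite_of_card_ne_zero (hI ▸ hq.ne_zero)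
    have := Fintype.ofFinite (R ⧸ I)
    let e := ZMod.ringEquivOfPrime (R ⧸ I) hq (by rw [← Nat.card_eq_fintype_card, hI])
    apply hτ (e.symm (Ideal.Quotient.mk I θ))
    apply e.injective
    have := congrArg (Ideal.Quotient.mk I) hθ
    simp only [map_pow, map_sub, map_intCast] at this
    simp [this]

end QuadraticOrder

section RootCriterion

lemma legendreSym.neg_prime_eq {p q : ℕ} [Fact p.Prime] [Fact q.Prime] (hp4 : p % 4 = 3)
    (hq2 : q ≠ 2) : legendreSym q (-p) = legendreSym p q := by
  have hp2 : p ≠ 2 := by lia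
  have hq := (Fact.out : q.Prime).eq_two_or_odd.resolve_left hq2
  have hpo : Odd (p / 2) := by rw [Nat.odd_iff]; lia
  rw [neg_eq_neg_one_mul, legendreSym.mul, legendreSym.at_neg_one hq2, ZMod.χ₄_eq_neg_one_pow hq,
    legendreSym.quadratic_reciprocity' hp2 hq2, pow_mul, hpo.neg_one_pow, ← mul_assoc, ← mul_pow]
  simp

lemma ZMod.exists_sq_sub_add_eq_zero_iff :
    ∀ d : ZMod 2, (∃ τ : ZMod 2, τ ^ 2 - τ + d = 0) ↔ d = 0 := by
  decide

lemma exists_root_iff_legendreSym_eq_one {p q : ℕ} [Fact p.Prime] [Fact q.Prime] (hp4 : p % 4 = 3)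
    (hpq : q ≠ p) {c : ℕ} (hc : p + 1 = 4 * c) :
    (∃ τ : ZMod q, τ ^ 2 - τ + c = 0) ↔ legendreSym p q = 1 := by
  by_cases hq2 : q = 2
  · subst hq2
    have h2 := legendreSym.at_two (p := p) (by lia)
    rw [Nat.cast_ofNat, h2, ZMod.χ₈_nat_eq_if_mod_eight]
    have hc2 : (∃ τ : ZMod 2, τ ^ 2 - τ + c = 0) ↔ (c : ZMod 2) = 0 := by
      exact ZMod.exists_sq_sub_add_eq_zero_iff _
    rw [hc2, ZMod.natCast_eq_zero_iff]
    split_ifs <;> simp <;> lia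
  · rw [← legendreSym.neg_prime_eq hp4 hq2, legendreSym.eq_one_iff]
    · have h2 : (2 : ZMod q) ≠ 0 := by
        have := Ring.two_ne_zero (R := ZMod q) (by rwa [ZMod.ringChar_zmod_n])
        exact this
      have hcq : (p : ZMod q) + 1 = 4 * c := by exact_mod_cast congrArg (Nat.cast : ℕ → ZMod q) hc
      constructor
      · rintro ⟨τ, hτ⟩
        exact ⟨2 * τ - 1, by push_cast; linear_combination -4 * hτ - hcq⟩
      · rintro ⟨y, hy⟩
        push_cast at hy
        refine ⟨(1 + y) / 2, ?_⟩
        field_simp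
        linear_combination -hy - hcq
    · rw [Int.cast_neg, neg_ne_zero, Int.cast_natCast, Ne, ZMod.natCast_eq_zero_iff,
        Nat.prime_dvd_prime_iff_eq Fact.out Fact.out]
      exact hpq

end RootCriterion

section QuadraticOrder

variable {R : Type*} [CommRing R] [IsDedekindDomain R] [Module.Free ℤ R]

lemma Ideal.card_absNorm_prime_pow_eq_sum_legendreChar (hfin : Module.finrank ℤ R = 2)
    {p : ℕ} [Fact p.Prime] (hp4 : p % 4 = 3) {c : ℕ} (hc : p + 1 = 4 * c)
    {θ : R} (hθ : θ ^ 2 = θ - (c : ℤ))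
    (hinj : ∀ x y : ℤ, (x : R) + y * θ = 0 → x = 0 ∧ y = 0)
    (hspan : ∀ r : R, ∃ x y : ℤ, r = x + y * θ) {q : ℕ} (hq : q.Prime) (k : ℕ) :
    (Nat.card {I : Ideal R // Ideal.absNorm I = q ^ k} : ℂ) =
      ∑ i ∈ Finset.range (k + 1), legendreChar p q ^ i := by
  have : Fact q.Prime := ⟨hq⟩
  have hcR : (p : R) + 1 = 4 * c := by exact_mod_cast congrArg (Nat.cast : ℕ → R) hc
  rw [legendreChar_natCast]
  by_cases hqp : q = p
  · subst hqp
    have hβ : (2 * θ - 1) ^ 2 = -(q : R) := by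
      push_cast at hθ
      linear_combination 4 * hθ + hcR
    rw [Ideal.card_absNorm_prime_pow_of_sq_eq_neg hfin hq hβ]
    have : legendreSym q (q : ℤ) = 0 := by
      rw [legendreSym.eq_zero_iff]
      simp
    rw [this, Finset.sum_range_succ']
    simp
  · have hiff := exists_root_iff_legendreSym_eq_one hp4 hqp hc
    have hq0 : ((q : ℤ) : ZMod p) ≠ 0 := by
      rw [Int.cast_natCast, Ne, ZMod.natCast_eq_zero_iff, Nat.prime_dvd_prime_iff_eq Fact.out hq]
      exact Ne.symm hqp
    rcases legendreSym.eq_one_or_neg_one p hq0 with h1 | h1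
    · rw [h1]
      obtain ⟨τ, hτ⟩ := hiff.mpr h1
      obtain ⟨τ, rfl⟩ := ZMod.intCast_surjective τ
      rw [Ideal.card_absNorm_prime_pow_of_root hfin hq hθ hinj hspan (τ := τ)]
      · simp
      · rw [← ZMod.intCast_zmod_eq_zero_iff_dvd]
        exact_mod_cast hτ
      · rw [← ZMod.intCast_zmod_eq_zero_iff_dvd]
        intro h
        have hcq : (p : ZMod q) + 1 = 4 * c := by
          exact_mod_cast congrArg (Nat.cast : ℕ → ZMod q) hc
        push_cast at h
        have : (p : ZMod q) = 0 := by linear_combination hcq + 4 * hτ - (2 * τ - 1) * h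
        rw [ZMod.natCast_eq_zero_iff, Nat.prime_dvd_prime_iff_eq hq Fact.out] at this
        exact hqp this
    · rw [Ideal.card_absNorm_prime_pow_of_no_root hfin hq hθ, h1]
      · rw [Int.cast_neg, Int.cast_one, neg_one_geom_sum]
        rcases Nat.even_or_odd k with hk | hk
        · simp [hk, Nat.even_add_one]
        · simp [hk]
      · intro τ hτ
        rw [Int.cast_natCast] at hτ
        have := hiff.mp ⟨τ, hτ⟩
        lia

end QuadraticOrder

section DedekindZeta

variable {R : Type*} [CommRing R] [IsDedekindDomain R] [Module.Free ℤ R]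

lemma Ideal.card_absNorm_eq_zetaMul (hfin : Module.finrank ℤ R = 2)
    {p : ℕ} [Fact p.Prime] (hp4 : p % 4 = 3) {c : ℕ} (hc : p + 1 = 4 * c)
    {θ : R} (hθ : θ ^ 2 = θ - (c : ℤ))
    (hinj : ∀ x y : ℤ, (x : R) + y * θ = 0 → x = 0 ∧ y = 0)
    (hspan : ∀ r : R, ∃ x y : ℤ, r = x + y * θ) {n : ℕ} (hn : n ≠ 0) :
    (Nat.card {I : Ideal R // Ideal.absNorm I = n} : ℂ) = (legendreChar p).zetaMul n := by
  have : Module.Finite ℤ R := Module.finite_of_finrank_pos (by lia)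
  let f : ArithmeticFunction ℂ :=
    ⟨fun n ↦ if n = 0 then 0 else Nat.card {I : Ideal R // Ideal.absNorm I = n}, by simp⟩
  have hf : ∀ n : ℕ, n ≠ 0 → f n = Nat.card {I : Ideal R // Ideal.absNorm I = n} :=
    fun n hn ↦ if_neg hn
  have hfm : f.IsMultiplicative := by
    rw [ArithmeticFunction.IsMultiplicative.iff_ne_zero]
    refine ⟨by rw [hf 1 one_ne_zero, Ideal.card_absNorm_one, Nat.cast_one], ?_⟩
    intro m n hm hn hmn
    rw [hf _ (mul_ne_zero hm hn), hf _ hm, hf _ hn, Ideal.card_absNorm_mul hmn, Nat.cast_mul]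
  rw [← hf n hn]
  refine DFunLike.congr_fun ((hfm.eq_iff_eq_on_prime_powers _ _
    (legendreChar p).isMultiplicative_zetaMul).mpr fun q k hq ↦ ?_) n
  rw [hf _ (pow_ne_zero _ hq.ne_zero),
    Ideal.card_absNorm_prime_pow_eq_sum_legendreChar hfin hp4 hc hθ hinj hspan hq,
    DirichletCharacter.zetaMul, ArithmeticFunction.coe_zeta_mul_apply,
    Nat.sum_divisors_prime_pow hq]
  refine Finset.sum_congr rfl fun i _ ↦ ?_
  simp [toArithmeticFunction, hq.ne_zero]

lemma Ideal.LSeries_card_absNorm_eq (hfin : Module.finrank ℤ R = 2)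
    {p : ℕ} [Fact p.Prime] (hp4 : p % 4 = 3) {c : ℕ} (hc : p + 1 = 4 * c)
    {θ : R} (hθ : θ ^ 2 = θ - (c : ℤ))
    (hinj : ∀ x y : ℤ, (x : R) + y * θ = 0 → x = 0 ∧ y = 0)
    (hspan : ∀ r : R, ∃ x y : ℤ, r = x + y * θ) {s : ℂ} (hs : 1 < s.re) :
    LSeries (fun n ↦ Nat.card {I : Ideal R // Ideal.absNorm I = n}) s =
      riemannZeta s * LSeries (fun n ↦ legendreChar p n) s := by
  rw [LSeries_congr (g := (legendreChar p).zetaMul) (fun hn ↦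
    Ideal.card_absNorm_eq_zetaMul hfin hp4 hc hθ hinj hspan hn) s,
    DirichletCharacter.zetaMul, ← ArithmeticFunction.coe_mul,
    LSeries_convolution']
  · congr 1
    · simp_rw [← ArithmeticFunction.LSeries_zeta_eq_riemannZeta hs,
        ← ArithmeticFunction.natCoe_apply]
    · exact (LSeries_congr (legendreChar p).apply_eq_toArithmeticFunction_apply s).symm
  · exact ArithmeticFunction.LSeriesSummable_zeta_iff.mpr hs
  · exact (LSeriesSummable_congr _ fun h ↦
      ((legendreChar p).apply_eq_toArithmeticFunction_apply h).symm).mpr <|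
      ZMod.LSeriesSummable_of_one_lt_re (legendreChar p) hs

open NumberField Filter Topology in
lemma NumberField.dedekindZeta_residue_eq_of_legendre (K : Type*) [Field K] [NumberField K]
    (hfin : Module.finrank ℤ (𝓞 K) = 2)
    {p : ℕ} [Fact p.Prime] (hp4 : p % 4 = 3) {c : ℕ} (hc : p + 1 = 4 * c)
    {θ : 𝓞 K} (hθ : θ ^ 2 = θ - (c : ℤ))
    (hinj : ∀ x y : ℤ, (x : 𝓞 K) + y * θ = 0 → x = 0 ∧ y = 0)
    (hspan : ∀ r : 𝓞 K, ∃ x y : ℤ, r = x + y * θ) :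
    (dedekindZeta_residue K : ℂ) =
      -(Real.pi / (p * √p)) * ∑ a ∈ Finset.Icc 1 (p - 1), (legendreSym p a : ℂ) * a := by
  have hz : Tendsto (fun s : ℝ ↦ ((s : ℂ) - 1) * riemannZeta s) (𝓝[>] 1) (𝓝 1) := by
    refine riemannZeta_residue_one.comp (tendsto_nhdsWithin_iff.mpr ⟨?_, ?_⟩)
    · exact (Complex.continuous_ofReal.tendsto' 1 1 Complex.ofReal_one).mono_left
        nhdsWithin_le_nhds
    · filter_upwards [self_mem_nhdsWithin] with s hs
      have : s ≠ 1 := ne_of_gt hs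
      simpa using this
  have h := hz.mul (tendsto_LSeries_legendreChar p hp4)
  rw [one_mul] at h
  refine tendsto_nhds_unique (tendsto_sub_one_mul_dedekindZeta_nhdsGT K) (h.congr' ?_)
  filter_upwards [self_mem_nhdsWithin] with s hs
  rw [dedekindZeta, Ideal.LSeries_card_absNorm_eq hfin hp4 hc hθ hinj hspan
    (by simpa using hs), mul_assoc]

end DedekindZeta

section ImaginaryQuadratic

variable {K : Type*} [Field K] [NumberField K] {p : ℕ} {α : K}

lemma exists_rat_add_rat_mul (hα : α ^ 2 = -(p : K))
    (hgen : Algebra.adjoin ℚ ({α} : Set K) = ⊤) (x : K) : ∃ a b : ℚ, x = a + b * α := by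
  have hx : x ∈ Algebra.adjoin ℚ ({α} : Set K) := hgen ▸ Algebra.mem_top
  induction hx using Algebra.adjoin_induction with
  | mem x hx => exact ⟨0, 1, by simpa using hx⟩
  | algebraMap r => exact ⟨r, 0, by simp⟩
  | add x y _ _ hx hy =>
    obtain ⟨a, b, rfl⟩ := hx
    obtain ⟨a', b', rfl⟩ := hy
    exact ⟨a + a', b + b', by push_cast; ring⟩
  | mul x y _ _ hx hy =>
    obtain ⟨a, b, rfl⟩ := hx
    obtain ⟨a', b', rfl⟩ := hy
    exact ⟨a * a' - p * b * b', a * b' + a' * b, by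
      push_cast; linear_combination (b * b' : K) * hα⟩

lemma eq_zero_of_rat_add_rat_mul_eq_zero (hp : 0 < p) (hα : α ^ 2 = -(p : K)) {a b : ℚ}
    (h : (a + b * α : K) = 0) : a = 0 ∧ b = 0 := by
  have h1 : a ^ 2 + p * b ^ 2 = 0 := by
    have : ((a ^ 2 + p * b ^ 2 : ℚ) : K) = 0 := by
      push_cast
      linear_combination (a - b * α : K) * h - (b ^ 2 : K) * hα + 2 * (b : K) ^ 2 * hα
    exact_mod_cast this
  have hp' : (0 : ℚ) < p := by exact_mod_cast hp
  have hb : b = 0 := by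
    by_contra hb
    have : 0 < p * b ^ 2 := by positivity
    nlinarith [sq_nonneg a]
  subst hb
  simpa using h1

/-- The basis `1, α` of a quadratic field generated by a square root `α` of `-p`. -/
noncomputable def sqrtNegBasis (hp : 0 < p) (hα : α ^ 2 = -(p : K))
    (hgen : Algebra.adjoin ℚ ({α} : Set K) = ⊤) : Module.Basis (Fin 2) ℚ K :=
  Module.Basis.mk (v := ![1, α])
    (by
      rw [LinearIndependent.pair_iff]
      intro a b h
      exact eq_zero_of_rat_add_rat_mul_eq_zero hp hα (by simpa [Algebra.smul_def] using h))
    (by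
      intro x _
      obtain ⟨a, b, rfl⟩ := exists_rat_add_rat_mul hα hgen x
      rw [Matrix.range_cons, Matrix.range_cons, Matrix.range_empty, Set.union_empty,
        Set.singleton_union, Submodule.mem_span_pair]
      exact ⟨a, b, by simp [Algebra.smul_def]⟩)

lemma finrank_eq_two_of_sq_eq_neg (hp : 0 < p) (hα : α ^ 2 = -(p : K))
    (hgen : Algebra.adjoin ℚ ({α} : Set K) = ⊤) : Module.finrank ℚ K = 2 := by
  rw [Module.finrank_eq_card_basis (sqrtNegBasis hp hα hgen), Fintype.card_fin]

lemma trace_rat_add_rat_mul (hp : 0 < p) (hα : α ^ 2 = -(p : K))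
    (hgen : Algebra.adjoin ℚ ({α} : Set K) = ⊤) (a b : ℚ) :
    Algebra.trace ℚ K (a + b * α) = 2 * a := by
  have hα0 : Algebra.trace ℚ K α = 0 := by
    set e := sqrtNegBasis hp hα hgen with he
    have e0 : e 0 = 1 := by simp [he, sqrtNegBasis]
    have e1 : e 1 = α := by simp [he, sqrtNegBasis]
    rw [Algebra.trace_eq_matrix_trace e, Matrix.trace_fin_two, Algebra.leftMulMatrix_eq_repr_mul,
      Algebra.leftMulMatrix_eq_repr_mul, e0, mul_one, e1, ← pow_two, hα]
    have h : (-(p : K)) = (-(p : ℚ)) • e 0 := by simp [e0, Algebra.smul_def]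
    rw [h, map_smul, ← e1]
    simp
  have h : (a + b * α : K) = algebraMap ℚ K a + b • α := by simp [Algebra.smul_def]
  rw [h, map_add, map_smul, hα0, Algebra.trace_algebraMap, finrank_eq_two_of_sq_eq_neg hp hα hgen]
  simp

end ImaginaryQuadratic

section RingOfIntegers

open NumberField

variable {K : Type*} [Field K] [NumberField K] {p : ℕ} {α : K}

lemma exists_int_trace_eq {x : K} (hx : IsIntegral ℤ x) : ∃ m : ℤ, Algebra.trace ℚ K x = m := by
  obtain ⟨m, hm⟩ := IsIntegrallyClosed.isIntegral_iff.mp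
    (Algebra.isIntegral_trace (L := ℚ) hx)
  exact ⟨m, by simpa using hm.symm⟩

lemma exists_int_of_isIntegral [Fact p.Prime] (hp2 : p ≠ 2) (hα : α ^ 2 = -(p : K))
    (hgen : Algebra.adjoin ℚ ({α} : Set K) = ⊤) {x : K} (hx : IsIntegral ℤ x) :
    ∃ m n : ℤ, x = m + n * ((1 + α) / 2) := by
  have hp : p.Prime := Fact.out
  have hpZ := Nat.prime_iff_prime_int.mp hp
  obtain ⟨a, b, rfl⟩ := exists_rat_add_rat_mul hα hgen x
  have htr := trace_rat_add_rat_mul hp.pos hα hgen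
  have hαint : IsIntegral ℤ α := by
    refine IsIntegral.of_pow two_pos ?_
    rw [hα]
    exact (isIntegral_natCast p).neg
  obtain ⟨m, hm⟩ := exists_int_trace_eq hx
  obtain ⟨l, hl⟩ := exists_int_trace_eq (hx.mul hαint)
  obtain ⟨t, ht⟩ := exists_int_trace_eq (hx.pow 2)
  have e1 : (a + b * α : K) * α = ((-(p * b) : ℚ) : K) + a * α := by
    push_cast
    linear_combination (b : K) * hα
  have e2 : (a + b * α : K) ^ 2 = ((a ^ 2 - p * b ^ 2 : ℚ) : K) + ((2 * a * b : ℚ) : K) * α := by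
    push_cast
    linear_combination (b : K) ^ 2 * hα
  rw [htr] at hm
  rw [e1, htr] at hl
  rw [e2, htr] at ht
  have h1 : p * m ^ 2 - l ^ 2 = 2 * p * t := by
    have : (p * m ^ 2 - l ^ 2 : ℚ) = 2 * p * t := by
      rw [← hm, ← hl, ← ht]
      ring
    exact_mod_cast this
  obtain ⟨k, rfl⟩ : (p : ℤ) ∣ l :=
    hpZ.dvd_of_dvd_pow (n := 2) ⟨m ^ 2 - 2 * t, by linear_combination -h1⟩
  have hk : (-k : ℚ) = 2 * b := by
    have : (p : ℚ) ≠ 0 := by exact_mod_cast hp.ne_zero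
    push_cast at hl
    apply mul_left_cancel₀ this
    linear_combination hl
  have h2 : m ^ 2 - p * k ^ 2 = 2 * t := by
    apply mul_left_cancel₀ hpZ.ne_zero
    linear_combination h1
  have h3 : Even (m + k) := by
    have hpo : Odd (p : ℤ) := by exact_mod_cast hp.odd_of_ne_two hp2
    have : Even (m ^ 2 - p * k ^ 2) := ⟨t, by lia⟩
    rw [Int.even_sub, Int.even_mul, Int.even_pow' two_ne_zero, Int.even_pow' two_ne_zero,
      ← Int.not_odd_iff_even (n := (p : ℤ))] at this
    rw [Int.even_add]
    tauto
  obtain ⟨r, hr⟩ := h3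
  refine ⟨r, -k, ?_⟩
  have ha : (a : K) = m / 2 := by
    rw [eq_div_iff two_ne_zero, mul_comm]
    exact_mod_cast congrArg (Rat.cast : ℚ → K) hm
  have hb : (b : K) = -k / 2 := by
    rw [eq_div_iff two_ne_zero, mul_comm]
    exact_mod_cast congrArg (Rat.cast : ℚ → K) hk.symm
  have hr' : (m : K) + k = r + r := by exact_mod_cast congrArg (Int.cast : ℤ → K) hr
  rw [ha, hb]
  push_cast
  linear_combination hr' / 2

lemma exists_ringOfIntegers_generator [Fact p.Prime] {c : ℕ} (hc : p + 1 = 4 * c)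
    (hα : α ^ 2 = -(p : K)) (hgen : Algebra.adjoin ℚ ({α} : Set K) = ⊤) :
    ∃ θ : 𝓞 K, algebraMap (𝓞 K) K θ = (1 + α) / 2 ∧ θ ^ 2 = θ - (c : ℤ) ∧
      (∀ x y : ℤ, (x : 𝓞 K) + y * θ = 0 → x = 0 ∧ y = 0) ∧
      ∀ r : 𝓞 K, ∃ x y : ℤ, r = x + y * θ := by
  have hp : p.Prime := Fact.out
  have hcK : (p : K) + 1 = 4 * c := by exact_mod_cast congrArg (Nat.cast : ℕ → K) hc
  have hsq : ((1 + α) / 2) ^ 2 = (1 + α) / 2 - c := by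
    field_simp
    linear_combination hα - hcK
  have hintegral : IsIntegral ℤ ((1 + α) / 2) := by
    refine ⟨Polynomial.X ^ 2 - Polynomial.X + Polynomial.C (c : ℤ), by monicity!, ?_⟩
    simp [hsq]
  obtain ⟨θ, hθ⟩ : ∃ θ : 𝓞 K, algebraMap (𝓞 K) K θ = (1 + α) / 2 := ⟨⟨_, hintegral⟩, rfl⟩
  refine ⟨θ, hθ, ?_, ?_, ?_⟩
  · apply RingOfIntegers.ext
    simpa [hθ] using hsq
  · intro x y h
    have h' := congrArg (algebraMap (𝓞 K) K) h
    have h2 := eq_zero_of_rat_add_rat_mul_eq_zero hp.pos hα (a := x + y / 2) (b := y / 2) (by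
      push_cast
      rw [map_add, map_mul, map_intCast, map_intCast, map_zero, hθ] at h'
      linear_combination h')
    have hy : y = 0 := by
      have := h2.2
      field_simp at this
      exact_mod_cast this
    subst hy
    have := h2.1
    simp at this
    exact ⟨this, rfl⟩
  · intro r
    obtain ⟨m, n, h⟩ := exists_int_of_isIntegral (by rintro rfl; lia) hα hgen r.isIntegral_coe
    refine ⟨m, n, RingOfIntegers.ext ?_⟩
    simpa [hθ] using h

end RingOfIntegers

section Invariants

open NumberField NumberField.InfinitePlace NumberField.Units

variable {K : Type*} [Field K] [NumberField K] {p : ℕ} {α : K}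

lemma nrRealPlaces_eq_zero_of_sq_eq_neg (hp : 0 < p) (hα : α ^ 2 = -(p : K)) :
    nrRealPlaces K = 0 := by
  classical
  refine Fintype.card_eq_zero_iff.mpr ⟨fun ⟨w, φ, hφ, _⟩ ↦ ?_⟩
  have h := congrArg hφ.embedding hα
  simp only [map_pow, map_neg, map_natCast] at h
  have : (0 : ℝ) < p := by exact_mod_cast hp
  nlinarith [sq_nonneg (hφ.embedding α)]

lemma nrComplexPlaces_eq_one_of_sq_eq_neg (hp : 0 < p) (hα : α ^ 2 = -(p : K))
    (hgen : Algebra.adjoin ℚ ({α} : Set K) = ⊤) : nrComplexPlaces K = 1 := by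
  have h := card_add_two_mul_card_eq_rank K
  rw [nrRealPlaces_eq_zero_of_sq_eq_neg hp hα, finrank_eq_two_of_sq_eq_neg hp hα hgen] at h
  lia

lemma regulator_eq_one_of_sq_eq_neg (hp : 0 < p) (hα : α ^ 2 = -(p : K))
    (hgen : Algebra.adjoin ℚ ({α} : Set K) = ⊤) : regulator K = 1 := by
  have h : rank K = 0 := by
    rw [rank, card_eq_nrRealPlaces_add_nrComplexPlaces, nrRealPlaces_eq_zero_of_sq_eq_neg hp hα,
      nrComplexPlaces_eq_one_of_sq_eq_neg hp hα hgen]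
  have : IsEmpty (Fin (rank K)) := by
    rw [h]
    infer_instance
  classical
  have : IsEmpty {w : InfinitePlace K // w ≠ dirichletUnitTheorem.w₀} :=
    (equivFinRank K).symm.isEmpty
  rw [regulator_eq_det', Matrix.det_isEmpty, abs_one]

lemma torsionOrder_eq_two_of_sq_eq_neg (hp : 4 < p) (hα : α ^ 2 = -(p : K))
    {θ : 𝓞 K} (hθ : algebraMap (𝓞 K) K θ = (1 + α) / 2)
    (hspan : ∀ r : 𝓞 K, ∃ x y : ℤ, r = x + y * θ) : torsionOrder K = 2 := by
  have key : ∀ u : torsion K, (u : (𝓞 K)ˣ) = 1 ∨ (u : (𝓞 K)ˣ) = -1 := by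
    intro u
    obtain ⟨φ⟩ : Nonempty (K →+* ℂ) := inferInstance
    obtain ⟨n, hn, hu⟩ := isOfFinOrder_iff_pow_eq_one.mp ((CommGroup.mem_torsion _).mp u.2)
    obtain ⟨x, y, hxy⟩ := hspan (u : (𝓞 K)ˣ)
    have hu' : (φ (algebraMap (𝓞 K) K (u : (𝓞 K)ˣ))) ^ n = 1 := by
      rw [← map_pow, ← map_pow, ← Units.val_pow_eq_pow_val, hu]
      simp
    have hnorm := Complex.norm_eq_one_of_pow_eq_one hu' hn.ne'
    have hβ : (φ α) ^ 2 = -(p : ℂ) := by rw [← map_pow, hα, map_neg, map_natCast]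
    have hre := congrArg Complex.re hβ
    have him := congrArg Complex.im hβ
    have hφ : φ (algebraMap (𝓞 K) K (u : (𝓞 K)ˣ)) = x + y * ((1 + φ α) / 2) := by
      rw [hxy]
      simp [hθ, map_ofNat]
    have hsq : Complex.normSq (φ (algebraMap (𝓞 K) K (u : (𝓞 K)ˣ))) = 1 := by
      rw [Complex.normSq_eq_norm_sq, hnorm, one_pow]
    have hp' : (4 : ℝ) < p := by exact_mod_cast hp
    simp [pow_two] at hre him
    have hre0 : (φ α).re = 0 := by
      by_contra h0
      have : (φ α).im = 0 := by
        apply mul_left_cancel₀ h0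
        linarith
      rw [this] at hre
      nlinarith [mul_self_nonneg (φ α).re]
    have hmain : (2 * x + y : ℝ) ^ 2 + p * y ^ 2 = 4 := by
      rw [hφ, Complex.normSq_apply] at hsq
      simp [hre0] at hsq hre
      linear_combination 4 * hsq - (y : ℝ) ^ 2 * hre
    have hmainZ : (2 * x + y) ^ 2 + p * y ^ 2 = 4 := by exact_mod_cast hmain
    have hy : y = 0 := by
      by_contra h0
      have : 0 < y ^ 2 := by positivity
      have hp'' : (4 : ℤ) < p := by exact_mod_cast hp
      nlinarith [sq_nonneg (2 * x + y)]
    subst hy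
    have hx : x ^ 2 = 1 := by lia
    rw [Units.ext_iff, Units.ext_iff, hxy]
    rcases sq_eq_one_iff.mp hx with rfl | rfl
    · simp
    · simp
  rw [torsionOrder, Nat.card_eq_two_iff]
  refine ⟨1, ⟨-1, neg_one_mem_torsion⟩, by simp [← Subtype.coe_ne_coe], ?_⟩
  refine Set.eq_univ_of_forall fun u ↦ ?_
  rw [Set.mem_insert_iff, Set.mem_singleton_iff, ← Subtype.val_inj, ← Subtype.val_inj]
  exact key u

lemma discr_eq_neg_of_sq_eq_neg {c : ℕ} (hc : p + 1 = 4 * c) (hp : 0 < p)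
    (hα : α ^ 2 = -(p : K)) (hgen : Algebra.adjoin ℚ ({α} : Set K) = ⊤)
    {θ : 𝓞 K} (hθ : algebraMap (𝓞 K) K θ = (1 + α) / 2) (hsq : θ ^ 2 = θ - (c : ℤ))
    (hinj : ∀ x y : ℤ, (x : 𝓞 K) + y * θ = 0 → x = 0 ∧ y = 0)
    (hspan : ∀ r : 𝓞 K, ∃ x y : ℤ, r = x + y * θ) : discr K = -p := by
  have htr : ∀ x y : ℤ, Algebra.trace ℤ (𝓞 K) (x + y * θ) = 2 * x + y := by
    intro x y
    have h : ((Algebra.trace ℤ (𝓞 K) (x + y * θ) : ℤ) : ℚ) = ((2 * x + y : ℤ) : ℚ) := by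
      have : algebraMap (𝓞 K) K (x + y * θ) = ((x + y / 2 : ℚ) : K) + ((y / 2 : ℚ) : K) * α := by
        rw [map_add, map_mul, hθ]
        push_cast
        simp
        ring
      refine (Algebra.coe_trace_int _).trans ((congrArg _ this).trans ?_)
      rw [trace_rat_add_rat_mul hp hα hgen]
      push_cast
      ring
    exact_mod_cast h
  let b : Module.Basis (Fin 2) ℤ (𝓞 K) := Module.Basis.mk (v := ![1, θ])
    (by
      rw [LinearIndependent.pair_iff]
      intro x y h
      exact hinj x y (by simpa using h))
    (by
      intro r _
      obtain ⟨x, y, rfl⟩ := hspan r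
      rw [Matrix.range_cons, Matrix.range_cons, Matrix.range_empty, Set.union_empty,
        Set.singleton_union, Submodule.mem_span_pair]
      exact ⟨x, y, by simp⟩)
  have b0 : b 0 = 1 := by simp [b]
  have b1 : b 1 = θ := by simp [b]
  have t1 : Algebra.trace ℤ (𝓞 K) 1 = 2 := by simpa using htr 1 0
  have t2 : Algebra.trace ℤ (𝓞 K) θ = 1 := by simpa using htr 0 1
  have t3 : Algebra.trace ℤ (𝓞 K) (θ * θ) = 1 - 2 * c := by
    rw [← pow_two, hsq]
    have := htr (-c) 1
    push_cast at this ⊢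
    rw [show θ - (c : 𝓞 K) = -(c : 𝓞 K) + 1 * θ by ring, this]
    ring
  rw [← discr_eq_discr K b, Algebra.discr_def, Matrix.det_fin_two]
  simp only [Algebra.traceMatrix_apply, Algebra.traceForm_apply, b0, b1, mul_one, one_mul, t1, t2,
    t3]
  lia

end Invariants

/-- Dirichlet's class number formula for prime discriminant: if `p > 3` is a prime with
`p ≡ 3 (mod 4)` and `h` is the class number of `k = ℚ(√-p)` (formalized as a number field `K`
generated over `ℚ` by a square root `α` of `-p`), then
`h = -(1/p) · ∑_{a=1}^{p-1} (a|p) · a`. -/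
theorem class_number_formula_prime_discriminant (p : ℕ) [Fact p.Prime]
    (hp4 : p % 4 = 3) (hp : 3 < p)
    (K : Type) [Field K] [NumberField K] (α : K)
    (hα : α ^ 2 = -(p : K)) (hgen : Algebra.adjoin ℚ ({α} : Set K) = ⊤) :
    (NumberField.classNumber K : ℚ)
      = -(1 / (p : ℚ)) * ∑ a ∈ Finset.Icc 1 (p - 1), (legendreSym p a : ℚ) * (a : ℚ) := by
  obtain ⟨c, hc⟩ : ∃ c, p + 1 = 4 * c := ⟨(p + 1) / 4, by lia⟩
  have hp0 : 0 < p := by lia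
  obtain ⟨θ, hθ, hsq, hinj, hspan⟩ := exists_ringOfIntegers_generator hc hα hgen
  have hfin : Module.finrank ℤ (NumberField.RingOfIntegers K) = 2 := by
    rw [NumberField.RingOfIntegers.rank, finrank_eq_two_of_sq_eq_neg hp0 hα hgen]
  have h := NumberField.dedekindZeta_residue_eq_of_legendre K hfin hp4 hc hsq hinj hspan
  have habs : |((-(p : ℤ) : ℤ) : ℝ)| = p := by simp
  rw [NumberField.dedekindZeta_residue_def, nrRealPlaces_eq_zero_of_sq_eq_neg hp0 hα,
    nrComplexPlaces_eq_one_of_sq_eq_neg hp0 hα hgen, regulator_eq_one_of_sq_eq_neg hp0 hα hgen,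
    torsionOrder_eq_two_of_sq_eq_neg (by lia) hα hθ hspan,
    discr_eq_neg_of_sq_eq_neg hc hp0 hα hgen hθ hsq hinj hspan, habs] at h
  have hsqrt : ((√p : ℝ) : ℂ) ≠ 0 := by
    exact_mod_cast (Real.sqrt_pos.mpr (by exact_mod_cast hp0 : (0 : ℝ) < p)).ne'
  have hpC : (p : ℂ) ≠ 0 := by exact_mod_cast hp0.ne'
  have hπ : (Real.pi : ℂ) ≠ 0 := by exact_mod_cast Real.pi_ne_zero
  have hmain : (NumberField.classNumber K : ℂ)
      = -(1 / (p : ℂ)) * ∑ a ∈ Finset.Icc 1 (p - 1), (legendreSym p a : ℂ) * (a : ℂ) := by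
    push_cast at h
    field_simp at h ⊢
    linear_combination h
  apply Rat.cast_injective (α := ℂ)
  push_cast
  exact hmain
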